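/- Fix a real ε with 0 < ε < 10⁻² and set κ = 1/2 − ε. Then there exists a threshold N₀ (depending only on ε) such that for every natural number N ≥ N₀ satisfying |N − R²| ≤ 16·e^{2(log N)^κ} for some R ∈ ℕ, the set {(m,n) ∈ ℤ² : m² + n² = N and |n| ≤ 6·N^{1/4}·(log N)^{κ/4}} has at most 20 elements. -/

import Mathlib

open Polynomial in
theorem det_shifted_polynomials_ne_zero {m : ℕ} (e : Fin m → ℕ) (he : Function.Injective e)
    (P : Fin m → ℝ[X]) (hP : ∀ i, P i ≠ 0) {β : ℝ} (hβ : 0 < β) (hβ1 : β ≠ 1) :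
    (Matrix.of fun w i : Fin m =>
      (P i).comp (X + C (w : ℝ)) * C ((β ^ e i) ^ (w : ℕ))).det ≠ 0 := by
  intro h
  have hentry : ∀ w i : Fin m, (P i).comp (X + C (w : ℝ)) * C ((β ^ e i) ^ (w : ℕ)) ≠ 0 := by
    intro w i
    refine mul_ne_zero ?_ (C_ne_zero.mpr (by positivity))
    rw [Ne, ← leadingCoeff_eq_zero, leadingCoeff_comp (by rw [natDegree_X_add_C]; simp),
      leadingCoeff_X_add_C, one_pow, mul_one]
    exact leadingCoeff_ne_zero.mpr (hP i)
  have hdeg : ∀ w i : Fin m,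
      ((P i).comp (X + C (w : ℝ)) * C ((β ^ e i) ^ (w : ℕ))).natDegree = (P i).natDegree := by
    intro w i
    rw [natDegree_mul_C (by positivity), natDegree_comp,
      natDegree_X_add_C, mul_one]
  have hlead : ∀ w i : Fin m,
      ((P i).comp (X + C (w : ℝ)) * C ((β ^ e i) ^ (w : ℕ))).leadingCoeff =
        (P i).leadingCoeff * (β ^ e i) ^ (w : ℕ) := by
    intro w i
    rw [leadingCoeff_mul, leadingCoeff_comp (by rw [natDegree_X_add_C]; simp), leadingCoeff_C,
      leadingCoeff_X_add_C, one_pow, mul_one]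
  have hcoeff : (Matrix.of fun w i : Fin m =>
      (P i).comp (X + C (w : ℝ)) * C ((β ^ e i) ^ (w : ℕ))).det.coeff
        (∑ i, (P i).natDegree) =
      (∏ i, (P i).leadingCoeff) * (Matrix.vandermonde fun i => β ^ e i).det := by
    rw [← Matrix.det_transpose (Matrix.vandermonde _), Matrix.det_apply, Matrix.det_apply,
      finsetSum_coeff, Finset.mul_sum]
    refine Finset.sum_congr rfl fun σ _ => ?_
    rw [coeff_smul, mul_smul_comm]
    congr 1
    simp only [Matrix.of_apply, Matrix.transpose_apply, Matrix.vandermonde_apply]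
    rw [← Finset.prod_mul_distrib]
    have h1 := natDegree_prod Finset.univ (fun i : Fin m =>
      (P i).comp (X + C ((σ i : Fin m) : ℝ)) * C ((β ^ e i) ^ ((σ i : Fin m) : ℕ)))
      (fun i _ => hentry _ _)
    have h2 := leadingCoeff_prod Finset.univ (fun i : Fin m =>
      (P i).comp (X + C ((σ i : Fin m) : ℝ)) * C ((β ^ e i) ^ ((σ i : Fin m) : ℕ)))
    simp only [hdeg] at h1
    simp only [hlead] at h2
    rw [← h2, leadingCoeff, h1]
  rw [h, coeff_zero] at hcoeff
  have h1 : (∏ i, (P i).leadingCoeff) ≠ 0 :=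
    Finset.prod_ne_zero_iff.mpr fun i _ => leadingCoeff_ne_zero.mpr (hP i)
  have h2 : (Matrix.vandermonde fun i => β ^ e i).det ≠ 0 := by
    rw [Matrix.det_vandermonde_ne_zero_iff]
    intro i j hij
    exact he (pow_right_injective₀ hβ hβ1 hij)
  exact mul_ne_zero h1 h2 hcoeff.symm

open Polynomial in
theorem natDegree_det_le_mul {m d : ℕ} (M : Matrix (Fin m) (Fin m) ℝ[X])
    (hM : ∀ i j, (M i j).natDegree ≤ d) : M.det.natDegree ≤ m * d := by
  rw [Matrix.det_apply]
  refine natDegree_sum_le_of_forall_le _ _ fun σ _ => ?_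
  refine (natDegree_smul_le _ _).trans ((natDegree_prod_le _ _).trans ?_)
  calc ∑ i, (M (σ i) i).natDegree ≤ ∑ _i : Fin m, d := Finset.sum_le_sum fun i _ => hM _ _
    _ = m * d := by simp

open Polynomial in
/-- A zero estimate on the additive times the multiplicative group, after Laurent. -/
theorem exists_grid_point_ne_zero {d l : ℕ} (p : Fin l → ℝ[X]) (hdeg : ∀ i, (p i).natDegree ≤ d)
    (hp : p ≠ 0) {β η : ℝ} (hβ : 0 < β) (hβ1 : β ≠ 1) (hη : 0 < η) {q R S : ℕ} (hRq : R ≤ q)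
    (hRS : l * d < R * S) :
    ∃ r < R + l, ∃ s < S,
      ∑ i, (p i).eval ((r : ℝ) + q * s) * (β ^ r * η ^ s) ^ (i : ℕ) ≠ 0 := by
  classical
  by_contra! hzero
  set I : Finset (Fin l) := Finset.univ.filter fun i => p i ≠ 0 with hI
  have hIne : I.Nonempty := by
    obtain ⟨i, hi⟩ := Function.ne_iff.mp hp
    exact ⟨i, by simpa [hI] using hi⟩
  set m := I.card with hm
  have hml : m ≤ l := by simpa using Finset.card_le_univ I
  have hm0 : 0 < m := Finset.card_pos.mpr hIne
  set e : Fin m → Fin l := fun i => (I.equivFin.symm i : Fin l) with he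
  have hei : Function.Injective e := fun i j hij => I.equivFin.symm.injective (Subtype.ext hij)
  have hPne : ∀ i, p (e i) ≠ 0 := fun i => by
    exact (Finset.mem_filter.mp (I.equivFin.symm i).2).2
  set M : Matrix (Fin m) (Fin m) ℝ[X] := Matrix.of fun w i : Fin m =>
      (p (e i)).comp (X + C (w : ℝ)) * C ((β ^ (e i : ℕ)) ^ (w : ℕ)) with hMdef
  have hdet : M.det ≠ 0 := det_shifted_polynomials_ne_zero (fun i => (e i : ℕ))
    (fun i j hij => hei (Fin.ext hij)) (fun i => p (e i)) hPne hβ hβ1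
  have hdetdeg : M.det.natDegree ≤ m * d := by
    refine natDegree_det_le_mul M fun w i => ?_
    rw [hMdef, Matrix.of_apply, natDegree_mul_C (by positivity), natDegree_comp,
      natDegree_X_add_C, mul_one]
    exact hdeg (e i)
  have hsum : ∀ f : Fin l → ℝ, (∀ i, p i = 0 → f i = 0) → ∑ i, f (e i) = ∑ i, f i := by
    intro f hf
    rw [← Finset.sum_subset (Finset.subset_univ I)
      (fun i _ hi => hf i (by simpa [hI] using hi)), ← Finset.sum_coe_sort I]
    exact Equiv.sum_comp I.equivFin.symm (fun i : I => f i)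
  set Z : Finset (ℕ × ℕ) := Finset.range R ×ˢ Finset.range S with hZ
  have hinj : Set.InjOn (fun z : ℕ × ℕ => (z.1 : ℝ) + q * z.2) Z := by
    rintro ⟨r, s⟩ hz ⟨r', s'⟩ hz' h
    simp only [hZ, Finset.coe_product, Finset.coe_range, Set.mem_prod, Set.mem_Iio] at hz hz' h
    have h' : r + q * s = r' + q * s' := by exact_mod_cast h
    have h1 : r < q := by omega
    have h2 : r' < q := by omega
    have h3 := congrArg (· / q) h'
    have h4 := congrArg (· % q) h'
    have hq : 0 < q := by omega
    simp [Nat.add_mul_div_left _ _ hq, Nat.div_eq_of_lt h1, Nat.div_eq_of_lt h2] at h3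
    simp [Nat.mod_eq_of_lt h1, Nat.mod_eq_of_lt h2] at h4
    simp [h3, h4]
  have hroots : Z.image (fun z : ℕ × ℕ => (z.1 : ℝ) + q * z.2) ⊆ M.det.roots.toFinset := by
    intro x hx
    obtain ⟨⟨r, s⟩, hz, rfl⟩ := Finset.mem_image.mp hx
    simp only [hZ, Finset.mem_product, Finset.mem_range] at hz
    rw [Multiset.mem_toFinset, mem_roots hdet, IsRoot.def]
    set x0 : ℝ := (r : ℝ) + q * s with hx0
    have : (M.det).eval x0 = ((evalRingHom x0).mapMatrix M).det := by
      rw [← RingHom.map_det]; rfl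
    rw [this, ← Matrix.exists_mulVec_eq_zero_iff]
    refine ⟨fun i => (β ^ r * η ^ s) ^ (e i : ℕ), ?_, ?_⟩
    · intro h
      have := congrFun h ⟨0, hm0⟩
      simp only [Pi.zero_apply] at this
      exact absurd this (by positivity)
    · funext w
      have hw : (w : ℕ) < l := lt_of_lt_of_le w.2 hml
      have h0 := hzero (r + w) (by omega) s hz.2
      rw [← hsum (fun i => (p i).eval (((r + w : ℕ) : ℝ) + q * s) *
        (β ^ (r + w : ℕ) * η ^ s) ^ (i : ℕ)) (fun i hi => by simp [hi])] at h0
      simp only [Matrix.mulVec, dotProduct, Pi.zero_apply]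
      rw [← h0]
      refine Finset.sum_congr rfl fun i _ => ?_
      simp only [hMdef, RingHom.mapMatrix_apply, Matrix.map_apply, Matrix.of_apply,
        coe_evalRingHom, eval_mul, eval_comp, eval_add, eval_X, eval_C]
      have h5 : x0 + (w : ℝ) = ((r + w : ℕ) : ℝ) + q * s := by push_cast; ring
      rw [h5]
      ring
  have hcard := Finset.card_le_card hroots
  rw [Finset.card_image_of_injOn hinj, hZ, Finset.card_product, Finset.card_range,
    Finset.card_range] at hcard
  have h6 : M.det.roots.toFinset.card ≤ m * d :=
    (Multiset.toFinset_card_le _).trans ((card_roots' _).trans hdetdeg)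
  have h7 : m * d ≤ l * d := Nat.mul_le_mul_right _ hml
  omega

/-- Thue–Siegel pigeonhole: small nonzero integer combinations of real linear forms. -/
theorem exists_int_vec_abs_sum_le {ι κ : Type*} [Fintype ι] [Fintype κ] [DecidableEq ι]
    [DecidableEq κ]
    (a : κ → ι → ℝ) {Y V : ℝ} (hV : 0 < V) (P B : ℕ) (hB : 0 < B) (ha : ∀ j i, |a j i| ≤ Y)
    (hYV : (Fintype.card ι : ℝ) * (P * Y) ≤ V)
    (hcard : (B + 1) ^ Fintype.card κ < (P + 1) ^ Fintype.card ι) :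
    ∃ p : ι → ℤ, p ≠ 0 ∧ (∀ i, |p i| ≤ P) ∧ ∀ j, |∑ i, a j i * p i| ≤ 2 * V / B := by
  have hB' : (0 : ℝ) < B := by exact_mod_cast hB
  set v : (ι → Fin (P + 1)) → κ → ℝ := fun f j => ∑ i, a j i * (f i : ℕ) with hv
  have hvb : ∀ f j, |v f j| ≤ V := by
    intro f j
    refine le_trans (Finset.abs_sum_le_sum_abs _ _) (le_trans ?_ hYV)
    calc ∑ i, |a j i * ((f i : ℕ) : ℝ)| ≤ ∑ _i : ι, (P * Y) := by
          refine Finset.sum_le_sum fun i _ => ?_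
          rw [abs_mul, Nat.abs_cast, mul_comm]
          have h1 : ((f i : ℕ) : ℝ) ≤ P := by exact_mod_cast Nat.lt_succ_iff.mp (f i).2
          exact mul_le_mul h1 (ha j i) (abs_nonneg _) (Nat.cast_nonneg _)
      _ = Fintype.card ι * (P * Y) := by simp
  have hw : 0 < 2 * V / B := by positivity
  have hbox : ∀ f j, ⌊(v f j + V) / (2 * V / B)⌋₊ < B + 1 := by
    intro f j
    have h1 := abs_le.mp (hvb f j)
    rw [Nat.floor_lt (by apply div_nonneg <;> linarith), div_lt_iff₀ hw]
    have : ((B + 1 : ℕ) : ℝ) * (2 * V / B) = 2 * V + 2 * V / B := by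
      push_cast; field_simp
    rw [this]; linarith
  set g : (ι → Fin (P + 1)) → (κ → Fin (B + 1)) := fun f j => ⟨_, hbox f j⟩ with hg
  obtain ⟨f, f', hne, hff⟩ := Fintype.exists_ne_map_eq_of_card_lt g (by simpa using hcard)
  refine ⟨fun i => (f i : ℕ) - (f' i : ℕ), ?_, ?_, ?_⟩
  · intro h
    apply hne
    funext i
    have := congrFun h i
    simp only [Pi.zero_apply] at this
    exact Fin.ext (by omega)
  · intro i
    have := (f i).2
    have := (f' i).2
    rw [abs_le]; dsimp only; constructor <;> omega
  · intro j
    have h1 : ∑ i, a j i * (((f i : ℕ) - (f' i : ℕ) : ℤ) : ℝ) = v f j - v f' j := by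
      rw [hv, ← Finset.sum_sub_distrib]
      refine Finset.sum_congr rfl fun i _ => ?_
      push_cast; ring
    rw [h1]
    have h2 : ⌊(v f j + V) / (2 * V / B)⌋₊ = ⌊(v f' j + V) / (2 * V / B)⌋₊ := by
      have := congrFun hff j
      simpa [hg] using this
    have h3 : ∀ f, 0 ≤ (v f j + V) / (2 * V / B) := fun f => by
      have := abs_le.mp (hvb f j)
      exact div_nonneg (by linarith) hw.le
    have e1 := Nat.floor_le (h3 f)
    have e2 := Nat.lt_floor_add_one ((v f j + V) / (2 * V / B))
    have e3 := Nat.floor_le (h3 f')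
    have e4 := Nat.lt_floor_add_one ((v f' j + V) / (2 * V / B))
    rw [h2] at e1 e2
    have e5 : |(v f j + V) / (2 * V / B) - (v f' j + V) / (2 * V / B)| ≤ 1 := by
      rw [abs_le]; constructor <;> linarith
    rw [← sub_div, abs_div, abs_of_pos hw, div_le_one hw] at e5
    simpa using e5

theorem abs_exp_sub_sum_le {z W : ℝ} (hz : |z| ≤ W) (m : ℕ) :
    |Real.exp z - ∑ i ∈ Finset.range m, z ^ i / i.factorial| ≤ Real.exp (3 * W - m) := by
  have hs : HasSum (fun i : ℕ => z ^ i / (i.factorial : ℝ)) (Real.exp z) := by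
    have := NormedSpace.expSeries_div_hasSum_exp (𝔸 := ℝ) z
    rwa [← Real.exp_eq_exp_ℝ] at this
  have hs' : HasSum (fun i : ℕ => z ^ (i + m) / ((i + m).factorial : ℝ))
      (Real.exp z - ∑ i ∈ Finset.range m, z ^ i / i.factorial) := (hasSum_nat_add_iff' m).mpr hs
  have ht : HasSum (fun i : ℕ => (3 * W) ^ i / (i.factorial : ℝ)) (Real.exp (3 * W)) := by
    have := NormedSpace.expSeries_div_hasSum_exp (𝔸 := ℝ) (3 * W)
    rwa [← Real.exp_eq_exp_ℝ] at this
  have hW : 0 ≤ W := (abs_nonneg z).trans hz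
  have ht' : HasSum (fun i : ℕ => (3 * W) ^ (i + m) / ((i + m).factorial : ℝ))
      (Real.exp (3 * W) - ∑ i ∈ Finset.range m, (3 * W) ^ i / i.factorial) :=
    (hasSum_nat_add_iff' m).mpr ht
  have hpos : 0 ≤ ∑ i ∈ Finset.range m, (3 * W) ^ i / (i.factorial : ℝ) :=
    Finset.sum_nonneg fun i _ => by positivity
  have hbound := hs'.norm_le_of_bounded (ht'.mul_left (Real.exp (-m))) (fun i => by
    rw [Real.norm_eq_abs, abs_div, abs_pow, Nat.abs_cast, ← mul_div_assoc]
    apply div_le_div_of_nonneg_right _ (by positivity)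
    have h3 : Real.exp 1 ≤ 3 := by have := Real.exp_one_lt_d9; linarith
    have h1 : |z| ^ (i + m) ≤ W ^ (i + m) := pow_le_pow_left₀ (abs_nonneg _) hz _
    have h2 : (1 : ℝ) ≤ Real.exp (-m) * 3 ^ (i + m) := by
      have : Real.exp m ≤ 3 ^ (i + m) := by
        calc Real.exp m = Real.exp 1 ^ m := by rw [← Real.exp_nat_mul]; simp
          _ ≤ 3 ^ m := pow_le_pow_left₀ (Real.exp_pos _).le h3 _
          _ ≤ 3 ^ (i + m) := pow_le_pow_right₀ (by norm_num) (by omega)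
      rw [Real.exp_neg, inv_mul_eq_div, one_le_div (Real.exp_pos _)]
      exact this
    calc |z| ^ (i + m) ≤ 1 * W ^ (i + m) := by rw [one_mul]; exact h1
      _ ≤ (Real.exp (-m) * 3 ^ (i + m)) * W ^ (i + m) := by gcongr
      _ = Real.exp (-m) * (3 * W) ^ (i + m) := by rw [mul_pow]; ring)
  rw [Real.norm_eq_abs] at hbound
  refine hbound.trans ?_
  rw [show 3 * W - m = -(m : ℝ) + 3 * W by ring, Real.exp_add]
  gcongr
  linarith

/-- An exponential polynomial with bounded integer coefficients that is small on an interval. -/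
theorem exists_small_exp_polynomial {K l m P B : ℕ} (hK : 0 < K) (hl : 0 < l) (hP : 0 < P)
    (hB : 0 < B) {ω X W : ℝ}
    (hX : 1 ≤ X) (hW : l * (|ω| * X) ≤ W)
    (hcard : (B + 1) ^ (K + m) < (P + 1) ^ (l * K)) :
    ∃ p : Fin l → Fin K → ℤ, p ≠ 0 ∧ (∀ i k, |p i k| ≤ P) ∧ ∀ x : ℝ, 0 ≤ x → x ≤ X →
      |∑ i, ∑ k, (p i k : ℝ) * x ^ (k : ℕ) * Real.exp ((i : ℕ) * (ω * x))| ≤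
        (l * K) * P * X ^ K * ((K + m) * (2 * Real.exp W / B) + Real.exp (3 * W - m)) := by
  set a : Fin (K + m) → Fin l × Fin K → ℝ := fun j c =>
    if (c.2 : ℕ) ≤ j ∧ (j : ℕ) < c.2 + m then
      X ^ (c.2 : ℕ) * (((c.1 : ℕ) * (ω * X)) ^ ((j : ℕ) - c.2) / ((j : ℕ) - c.2).factorial)
    else 0 with ha
  have hX0 : 0 < X := by linarith
  have hzW : ∀ (i : Fin l) (x : ℝ), 0 ≤ x → x ≤ X → |((i : ℕ) : ℝ) * (ω * x)| ≤ W := by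
    intro i x hx0 hxX
    rw [abs_mul, Nat.abs_cast, abs_mul, abs_of_nonneg hx0]
    refine le_trans ?_ hW
    have : ((i : ℕ) : ℝ) ≤ l := by exact_mod_cast i.2.le
    gcongr
  have hab : ∀ j c, |a j c| ≤ X ^ K * Real.exp W := by
    intro j c
    rw [ha]
    dsimp only
    split_ifs with h
    · rw [abs_mul, abs_of_pos (by positivity : 0 < X ^ (c.2 : ℕ)), abs_div, abs_pow, Nat.abs_cast]
      have h1 := hzW c.1 X hX0.le le_rfl
      have h2 := Real.pow_div_factorial_le_exp (|((c.1 : ℕ) : ℝ) * (ω * X)|) (abs_nonneg _)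
        ((j : ℕ) - c.2)
      refine mul_le_mul (pow_le_pow_right₀ hX c.2.2.le)
        (h2.trans (Real.exp_le_exp.mpr h1)) (by positivity) (by positivity)
    · rw [abs_zero]; positivity
  have hlR : (0 : ℝ) < l := by exact_mod_cast hl
  have hKR : (0 : ℝ) < K := by exact_mod_cast hK
  have hPR : (0 : ℝ) < P := by exact_mod_cast hP
  obtain ⟨p, hp0, hpP, hps⟩ := exists_int_vec_abs_sum_le a
    (V := (l * K) * (P * (X ^ K * Real.exp W))) (by positivity) P B hB hab
    (by simp) (by simpa using hcard)
  refine ⟨fun i k => p (i, k), ?_, fun i k => hpP _, ?_⟩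
  · intro h
    apply hp0
    funext c
    exact congrFun (congrFun h c.1) c.2
  · intro x hx0 hxX
    set u : ℝ := x / X with hu
    have hu0 : 0 ≤ u := by positivity
    have hu1 : u ≤ 1 := (div_le_one hX0).mpr hxX
    have hxu : x = X * u := by rw [hu]; field_simp
    have htrunc : ∀ c : Fin l × Fin K,
        ∑ j, a j c * u ^ (j : ℕ) = x ^ (c.2 : ℕ) *
          ∑ i ∈ Finset.range m, ((c.1 : ℕ) * (ω * x)) ^ i / i.factorial := by
      intro c
      rw [Fin.sum_univ_eq_sum_range (fun j => (if (c.2 : ℕ) ≤ j ∧ j < c.2 + m then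
        X ^ (c.2 : ℕ) * (((c.1 : ℕ) * (ω * X)) ^ (j - c.2) / (j - (c.2 : ℕ)).factorial)
        else 0) * u ^ j) (K + m)]
      have h1 : ∑ j ∈ Finset.Ico (c.2 : ℕ) (c.2 + m), (if (c.2 : ℕ) ≤ j ∧ j < c.2 + m then
          X ^ (c.2 : ℕ) * (((c.1 : ℕ) * (ω * X)) ^ (j - c.2) / (j - (c.2 : ℕ)).factorial)
          else 0) * u ^ j = ∑ j ∈ Finset.range (K + m), (if (c.2 : ℕ) ≤ j ∧ j < c.2 + m then
          X ^ (c.2 : ℕ) * (((c.1 : ℕ) * (ω * X)) ^ (j - c.2) / (j - (c.2 : ℕ)).factorial)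
          else 0) * u ^ j := by
        refine Finset.sum_subset ?_ ?_
        · intro j hj
          have := c.2.2
          simp only [Finset.mem_Ico, Finset.mem_range] at hj ⊢
          omega
        · intro j _ hj
          rw [Finset.mem_Ico] at hj
          rw [if_neg hj, zero_mul]
      rw [← h1, Finset.sum_Ico_eq_sum_range, Finset.mul_sum, add_tsub_cancel_left]
      refine Finset.sum_congr rfl fun i hi => ?_
      rw [Finset.mem_range] at hi
      rw [if_pos (by omega), add_tsub_cancel_left, hxu]
      rw [pow_add, mul_pow X u, show ((c.1 : ℕ) : ℝ) * (ω * (X * u)) = ((c.1 : ℕ) * (ω * X)) * u by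
        ring, mul_pow _ u]
      ring
    have hsplit : ∑ i, ∑ k, (p (i, k) : ℝ) * x ^ (k : ℕ) * Real.exp ((i : ℕ) * (ω * x)) =
        ∑ j : Fin (K + m), (∑ c, a j c * p c) * u ^ (j : ℕ) +
        ∑ c : Fin l × Fin K, (p c : ℝ) * x ^ (c.2 : ℕ) * (Real.exp ((c.1 : ℕ) * (ω * x)) -
          ∑ i ∈ Finset.range m, ((c.1 : ℕ) * (ω * x)) ^ i / i.factorial) := by
      have h1 : ∑ j : Fin (K + m), (∑ c, a j c * p c) * u ^ (j : ℕ) =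
          ∑ c : Fin l × Fin K, (p c : ℝ) * (x ^ (c.2 : ℕ) *
          ∑ i ∈ Finset.range m, ((c.1 : ℕ) * (ω * x)) ^ i / i.factorial) := by
        simp_rw [← htrunc, Finset.sum_mul, Finset.mul_sum]
        rw [Finset.sum_comm]
        exact Finset.sum_congr rfl fun c _ => Finset.sum_congr rfl fun j _ => by ring
      rw [h1, ← Finset.sum_add_distrib, ← Finset.univ_product_univ, Finset.sum_product]
      exact Finset.sum_congr rfl fun c _ => Finset.sum_congr rfl fun j _ => by ring
    rw [hsplit]
    refine (abs_add_le _ _).trans ?_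
    rw [mul_add]
    refine add_le_add ?_ ?_
    · refine (Finset.abs_sum_le_sum_abs _ _).trans ?_
      calc ∑ j : Fin (K + m), |(∑ c, a j c * p c) * u ^ (j : ℕ)|
          ≤ ∑ _j : Fin (K + m), 2 * ((l * K) * (P * (X ^ K * Real.exp W))) / B := by
            refine Finset.sum_le_sum fun j _ => ?_
            rw [abs_mul, abs_of_nonneg (pow_nonneg hu0 _)]
            refine (mul_le_of_le_one_right (abs_nonneg _) (pow_le_one₀ hu0 hu1)).trans (hps j)
        _ = _ := by simp; ring
    · refine (Finset.abs_sum_le_sum_abs _ _).trans ?_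
      calc ∑ c : Fin l × Fin K, |(p c : ℝ) * x ^ (c.2 : ℕ) * (Real.exp ((c.1 : ℕ) * (ω * x)) -
          ∑ i ∈ Finset.range m, ((c.1 : ℕ) * (ω * x)) ^ i / i.factorial)|
          ≤ ∑ _c : Fin l × Fin K, P * X ^ K * Real.exp (3 * W - m) := by
            refine Finset.sum_le_sum fun c _ => ?_
            rw [abs_mul, abs_mul, abs_of_nonneg (pow_nonneg hx0 _)]
            have h1 : |(p c : ℝ)| ≤ P := by exact_mod_cast hpP c
            have h2 : x ^ (c.2 : ℕ) ≤ X ^ K :=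
              (pow_le_pow_left₀ hx0 hxX _).trans (pow_le_pow_right₀ hX c.2.2.le)
            have h3 := abs_exp_sub_sum_le (hzW c.1 x hx0 hxX) m
            gcongr
        _ = _ := by simp; ring

theorem le_exp_of_le_two_pow {x : ℝ} (k : ℕ) (hx : x ≤ 2 ^ k) : x ≤ Real.exp k := by
  refine hx.trans ?_
  have h : (2 : ℝ) ≤ Real.exp 1 := by have := Real.exp_one_gt_d9; linarith
  calc (2 : ℝ) ^ k ≤ Real.exp 1 ^ k := pow_le_pow_left₀ (by norm_num) h _
    _ = Real.exp k := by rw [← Real.exp_nat_mul]; simp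

open Polynomial in
theorem exists_grid_sum_ne_zero {K l : ℕ} (p : Fin l → Fin K → ℤ) (hp : p ≠ 0)
    {β η : ℝ} (hβ : 0 < β) (hβ1 : β ≠ 1) (hη : 0 < η) {q R S : ℕ} (hRq : R ≤ q)
    (hRS : l * K < R * S) :
    ∃ r < R + l, ∃ s < S, ∑ i, ∑ k, (p i k : ℝ) * ((r : ℝ) + q * s) ^ (k : ℕ) *
      (β ^ r * η ^ s) ^ (i : ℕ) ≠ 0 := by
  set f : Fin l → ℝ[X] := fun i => ∑ k, C (p i k : ℝ) * X ^ (k : ℕ) with hf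
  have hfdeg : ∀ i, (f i).natDegree ≤ K := fun i =>
    natDegree_sum_le_of_forall_le _ _ fun k _ => (natDegree_C_mul_X_pow_le _ _).trans k.2.le
  have hf0 : f ≠ 0 := by
    intro h
    apply hp
    funext i k
    have h1 := congrArg (fun g => coeff g k) (congrFun h i)
    simp only [hf, finsetSum_coeff, coeff_C_mul, coeff_X_pow, Pi.zero_apply, coeff_zero] at h1
    rw [Finset.sum_eq_single k (fun j _ hj => by
      rw [if_neg (fun h => hj (Fin.ext h.symm)), mul_zero]) (by simp)] at h1
    simpa using h1
  obtain ⟨r, hr, s, hs, h⟩ := exists_grid_point_ne_zero f hfdeg hf0 hβ hβ1 hη hRq hRS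
  refine ⟨r, hr, s, hs, ?_⟩
  convert h using 2 with i
  rw [hf]
  simp only [eval_finsetSum, eval_mul, eval_C, eval_pow, eval_X, Finset.sum_mul]

set_option maxHeartbeats 4000000 in
/-- A lower bound for a linear form `q log β - log (η / d)` in two logarithms, phrased as the
impossibility of a too small value. -/
theorem not_small_linear_form_two_logs (I : Subring (Fin 4 → ℝ))
    (hI : ∀ v ∈ I, v 0 ≠ 0 → 1 ≤ ∏ i, |v i|) {β η : Fin 4 → ℝ} (hβI : β ∈ I) (hηI : η ∈ I)
    {d h₁ h₂ l q : ℕ} (hd : 0 < d) (hh₁ : 0 < h₁) (hh₂ : 0 < h₂) (hl : 400000 ≤ l)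
    (hβ0 : 0 < β 0) (hβ1 : β 0 ≠ 1) (hη0 : 0 < η 0)
    (hβh : ∀ i, |β i| ≤ Real.exp h₁) (hηh : ∀ i, |η i| ≤ Real.exp h₂) (hdh : d ≤ Real.exp h₂)
    (hq : 1000 * l * h₂ ≤ q) (hω : q * |Real.log (β 0)| ≤ h₂)
    (hX : ((1000 * l * h₂ + l + q * (1000 * l * h₁) : ℕ) : ℝ) ≤ Real.exp (l / 400000))
    {E : ℝ} (hE : η 0 / d = β 0 ^ q * Real.exp E)
    (hEsmall : |E| ≤ Real.exp (-(13000 * ((l ^ 2 * h₁ * h₂ : ℕ) : ℝ)))) : False := by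
  set b : ℕ := l ^ 2 * h₁ * h₂ with hb
  have hlpos : 0 < l := by omega
  have hbpos : 0 < b := by positivity
  have hb1 : (1 : ℝ) ≤ b := by exact_mod_cast hbpos
  set K : ℕ := 400000 * l * h₁ * h₂ with hK
  have hKpos : 0 < K := by positivity
  have hKb : K ≤ b := by
    rw [hK, hb, sq]
    have : 400000 * l ≤ l * l := Nat.mul_le_mul_right _ hl
    exact Nat.mul_le_mul_right _ (Nat.mul_le_mul_right _ this)
  have hlK : l * K = 400000 * b := by rw [hK, hb]; ring
  set R : ℕ := 1000 * l * h₂ with hR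
  set S : ℕ := 1000 * l * h₁ with hS
  have hRS : l * K < R * S := by
    have : R * S = 1000000 * b := by rw [hR, hS, hb]; ring
    omega
  set X : ℝ := ((R + l + q * S : ℕ) : ℝ) with hXdef
  have hX1 : 1 ≤ X := by
    have h : 1 ≤ R + l + q * S := by omega
    rw [hXdef]; exact_mod_cast h
  have hXK : X ^ K ≤ Real.exp b := by
    calc X ^ K ≤ Real.exp (l / 400000) ^ K := pow_le_pow_left₀ (by linarith) hX _
      _ = Real.exp b := by
        rw [← Real.exp_nat_mul]
        congr 1
        rw [hK, hb]; push_cast; ring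
  set ω : ℝ := Real.log (β 0) with hωdef
  have hh₁R : (1 : ℝ) ≤ h₁ := by exact_mod_cast hh₁
  have hh₂R : (1 : ℝ) ≤ h₂ := by exact_mod_cast hh₂
  have hlR : (400000 : ℝ) ≤ l := by exact_mod_cast hl
  have hW : l * (|ω| * X) ≤ 1002 * (b : ℝ) := by
    have h1 : R + l ≤ 2 * q := by
      have : l ≤ R := by rw [hR]; nlinarith
      omega
    have h2 : ((R + l : ℕ) : ℝ) ≤ 2 * q := by exact_mod_cast h1
    have h3 : |ω| * X ≤ 2 * h₂ + h₂ * S := by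
      calc |ω| * X = |ω| * ((R + l : ℕ) : ℝ) + (q * |ω|) * S := by
            rw [hXdef]; push_cast; ring
        _ ≤ |ω| * (2 * q) + h₂ * S := by gcongr
        _ = 2 * (q * |ω|) + h₂ * S := by ring
        _ ≤ _ := by gcongr
    calc l * (|ω| * X) ≤ l * (2 * h₂ + h₂ * S) := by gcongr
      _ = 2 * (l * 1 * 1 * h₂) + 1000 * b := by rw [hS, hb]; push_cast; ring
      _ ≤ 2 * (l * l * h₁ * h₂) + 1000 * b := by gcongr; linarith
      _ = 1002 * b := by rw [hb]; push_cast; ring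
  set P : ℕ := 2 ^ (1000 * b) - 1 with hP
  have hP1 : P + 1 = 2 ^ (1000 * b) := Nat.sub_add_cancel Nat.one_le_two_pow
  set B : ℕ := 2 ^ (24400 * b) - 1 with hB
  have hB1 : B + 1 = 2 ^ (24400 * b) := Nat.sub_add_cancel Nat.one_le_two_pow
  have hPpos : 0 < P := by
    have : 2 ^ 1 ≤ 2 ^ (1000 * b) := Nat.pow_le_pow_right (by norm_num) (by omega)
    omega
  have hBge : 2 ^ (24400 * b - 1) ≤ B := by
    have h1 : 2 ^ (24400 * b) = 2 ^ (24400 * b - 1) * 2 := by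
      rw [← pow_succ]; congr 1; omega
    have h2 : 1 ≤ 2 ^ (24400 * b - 1) := Nat.one_le_two_pow
    omega
  have hBpos : 0 < B := lt_of_lt_of_le (by positivity) hBge
  have hPexp : (P : ℝ) ≤ Real.exp (1000 * b) := by
    have h1 : (P : ℝ) ≤ 2 ^ (1000 * b) := by exact_mod_cast (by omega : P ≤ 2 ^ (1000 * b))
    simpa using le_exp_of_le_two_pow _ h1
  have hBexp : Real.exp (12199 * b) ≤ B := by
    have h1 : Real.exp (12199 * b) ≤ 2 ^ (24400 * b - 1) := by
      have h2 : Real.exp (12199 * b) ≤ Real.exp ((24400 * b - 1 : ℕ) * (1 / 2)) := by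
        apply Real.exp_le_exp.mpr
        rw [Nat.cast_sub (by omega)]
        push_cast
        linarith
      refine h2.trans ?_
      rw [Real.exp_nat_mul]
      refine pow_le_pow_left₀ (Real.exp_pos _).le ?_ _
      have h3 : Real.exp (1 / 2) ^ 2 ≤ 2 ^ 2 := by
        rw [← Real.exp_nat_mul]
        have := Real.exp_one_lt_d9
        norm_num; linarith
      exact (abs_le_of_sq_le_sq' h3 (by norm_num)).2
    exact h1.trans (by exact_mod_cast hBge)
  have hcard : (B + 1) ^ (K + 15000 * b) < (P + 1) ^ (l * K) := by
    rw [hB1, hP1, ← pow_mul, ← pow_mul]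
    apply Nat.pow_lt_pow_right (by norm_num)
    rw [hlK]
    nlinarith
  obtain ⟨p, hp0, hpP, hpsmall⟩ := exists_small_exp_polynomial hKpos hlpos hPpos hBpos hX1 hW hcard
  obtain ⟨r, hr, s, hs, hne⟩ := exists_grid_sum_ne_zero p hp0 hβ0 hβ1
    (div_pos hη0 (Nat.cast_pos.mpr hd)) hq hRS
  set x : ℕ := r + q * s with hx
  have hxX : (x : ℝ) ≤ X := by
    have h1 : q * s ≤ q * S := Nat.mul_le_mul_left _ hs.le
    have h2 : x ≤ R + l + q * S := by omega
    rw [hXdef]; exact_mod_cast h2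
  have hxR : (r : ℝ) + q * s = x := by rw [hx]; push_cast; ring
  rw [hxR] at hne
  have hcoef : ((l : ℝ) * K) * P * X ^ K ≤ Real.exp (1021 * b) := by
    have h1 : (l : ℝ) * K ≤ Real.exp (20 * b) := by
      have h2 : (l : ℝ) * K = 400000 * b := by exact_mod_cast hlK
      rw [h2]
      calc (400000 : ℝ) * b ≤ Real.exp (19 : ℕ) * Real.exp b := by
            apply mul_le_mul (le_exp_of_le_two_pow 19 (by norm_num)) _ (by positivity)
              (Real.exp_pos _).le
            have := Real.add_one_le_exp (b : ℝ); linarith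
        _ = Real.exp (19 + b) := by rw [← Real.exp_add]; norm_num
        _ ≤ _ := Real.exp_le_exp.mpr (by linarith)
    calc ((l : ℝ) * K) * P * X ^ K ≤ Real.exp (20 * b) * Real.exp (1000 * b) * Real.exp b := by
          gcongr
      _ = Real.exp (1021 * b) := by rw [← Real.exp_add, ← Real.exp_add]; ring_nf
  -- the integral multiple of the value at the grid point
  set F : Fin 4 → ℝ := ∑ i : Fin l, ∑ k : Fin K,
    (p i k : Fin 4 → ℝ) * (x : Fin 4 → ℝ) ^ (k : ℕ) *
      (β ^ (r * (i : ℕ)) * (η ^ (s * (i : ℕ)) * (d : Fin 4 → ℝ) ^ (l * S - s * (i : ℕ)))) with hF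
  have hFI : F ∈ I := by
    refine sum_mem fun i _ => sum_mem fun k _ => ?_
    exact mul_mem (mul_mem (intCast_mem I _) (pow_mem (natCast_mem I _) _))
      (mul_mem (pow_mem hβI _) (mul_mem (pow_mem hηI _) (pow_mem (natCast_mem I _) _)))
  have hFj : ∀ j, F j = ∑ i : Fin l, ∑ k : Fin K, (p i k : ℝ) * (x : ℝ) ^ (k : ℕ) *
      (β j ^ (r * (i : ℕ)) * (η j ^ (s * (i : ℕ)) * (d : ℝ) ^ (l * S - s * (i : ℕ)))) := by
    intro j
    simp [hF, Finset.sum_apply]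
  have hsi : ∀ i : Fin l, s * (i : ℕ) ≤ l * S := fun i => by
    rw [mul_comm l S]; exact Nat.mul_le_mul hs.le i.2.le
  have hdR : (0 : ℝ) < d := Nat.cast_pos.mpr hd
  have hd1 : (1 : ℝ) ≤ d := by exact_mod_cast hd
  have hconj : ∀ j, |F j| ≤ Real.exp (3022 * b) := by
    intro j
    rw [hFj]
    have hterm : ∀ i : Fin l, ∀ k : Fin K, |(p i k : ℝ) * (x : ℝ) ^ (k : ℕ) *
        (β j ^ (r * (i : ℕ)) * (η j ^ (s * (i : ℕ)) * (d : ℝ) ^ (l * S - s * (i : ℕ))))| ≤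
        P * X ^ K * (Real.exp (1001 * b) * Real.exp (1000 * b)) := by
      intro i k
      have h1 : |(p i k : ℝ)| ≤ P := by exact_mod_cast hpP i k
      have h2 : (x : ℝ) ^ (k : ℕ) ≤ X ^ K :=
        (pow_le_pow_left₀ (Nat.cast_nonneg _) hxX _).trans (pow_le_pow_right₀ hX1 k.2.le)
      have h3 : |β j| ^ (r * (i : ℕ)) ≤ Real.exp (1001 * b) := by
        calc |β j| ^ (r * (i : ℕ)) ≤ Real.exp h₁ ^ (r * (i : ℕ)) :=
              pow_le_pow_left₀ (abs_nonneg _) (hβh j) _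
          _ = Real.exp ((r * (i : ℕ) * h₁ : ℕ)) := by
              rw [← Real.exp_nat_mul]; push_cast; ring_nf
          _ ≤ Real.exp ((1001 * b : ℕ)) := by
              apply Real.exp_le_exp.mpr
              apply Nat.cast_le.mpr
              calc r * (i : ℕ) * h₁ ≤ (R + l) * l * h₁ := by
                    gcongr; exact i.2.le
                _ = 1000 * b + l ^ 2 * h₁ * 1 := by rw [hR, hb]; ring
                _ ≤ 1000 * b + l ^ 2 * h₁ * h₂ := by gcongr; omega
                _ = 1001 * b := by rw [hb]; ring
          _ = _ := by push_cast; ring_nf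
      have h4 : |η j| ^ (s * (i : ℕ)) * (d : ℝ) ^ (l * S - s * (i : ℕ)) ≤
          Real.exp (1000 * b) := by
        calc |η j| ^ (s * (i : ℕ)) * (d : ℝ) ^ (l * S - s * (i : ℕ))
            ≤ Real.exp h₂ ^ (s * (i : ℕ)) * Real.exp h₂ ^ (l * S - s * (i : ℕ)) := by
              gcongr; exact hηh j
          _ = Real.exp h₂ ^ (l * S) := by rw [← pow_add, Nat.add_sub_cancel' (hsi i)]
          _ = Real.exp (1000 * b) := by
              rw [← Real.exp_nat_mul]; congr 1; rw [hS, hb]; push_cast; ring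
      rw [abs_mul, abs_mul, abs_mul, abs_mul, abs_pow, abs_pow, abs_pow, abs_pow, Nat.abs_cast,
        Nat.abs_cast]
      gcongr
    calc _ ≤ ∑ i : Fin l, ∑ k : Fin K, P * X ^ K * (Real.exp (1001 * b) * Real.exp (1000 * b)) :=
          (Finset.abs_sum_le_sum_abs _ _).trans (Finset.sum_le_sum fun i _ =>
            (Finset.abs_sum_le_sum_abs _ _).trans (Finset.sum_le_sum fun k _ => hterm i k))
      _ = (l * K) * P * X ^ K * (Real.exp (1001 * b) * Real.exp (1000 * b)) := by simp; ring
      _ ≤ Real.exp (1021 * b) * (Real.exp (1001 * b) * Real.exp (1000 * b)) := by gcongr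
      _ = _ := by rw [← Real.exp_add, ← Real.exp_add]; ring_nf
  have hF0eq : F 0 = (d : ℝ) ^ (l * S) * ∑ i : Fin l, ∑ k : Fin K,
      (p i k : ℝ) * (x : ℝ) ^ (k : ℕ) * (β 0 ^ r * (η 0 / d) ^ s) ^ (i : ℕ) := by
    rw [hFj, Finset.mul_sum]
    refine Finset.sum_congr rfl fun i _ => ?_
    rw [Finset.mul_sum]
    refine Finset.sum_congr rfl fun k _ => ?_
    have h1 : (d : ℝ) ^ (l * S) = (d : ℝ) ^ (s * (i : ℕ)) * (d : ℝ) ^ (l * S - s * (i : ℕ)) := by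
      rw [← pow_add, Nat.add_sub_cancel' (hsi i)]
    rw [h1, mul_pow, ← pow_mul, ← pow_mul, div_pow]
    field_simp
  have hF0 : F 0 ≠ 0 := by
    rw [hF0eq]
    exact mul_ne_zero (by positivity) hne
  have hnorm := hI F hFI hF0
  have hsum : |∑ i : Fin l, ∑ k : Fin K,
      (p i k : ℝ) * (x : ℝ) ^ (k : ℕ) * (β 0 ^ r * (η 0 / d) ^ s) ^ (i : ℕ)| ≤
      (l * K) * P * X ^ K * ((K + (15000 * b : ℕ)) * (2 * Real.exp (1002 * b) / B) +
        Real.exp (3 * (1002 * b) - (15000 * b : ℕ))) +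
      (l * K) * P * X ^ K * (Real.exp (1002 * b) * (2 * (l * S * |E|))) := by
    have hlS : (l : ℝ) * S * |E| ≤ 1 := by
      have h1 : (l : ℝ) * S ≤ Real.exp (1000 * b) := by
        have h2 : (l : ℝ) * S ≤ 1000 * b := by
          have : l * S ≤ 1000 * b := by
            calc l * S = 1000 * (l ^ 2 * h₁ * 1) := by rw [hS]; ring
              _ ≤ 1000 * b := by rw [hb]; gcongr; omega
          exact_mod_cast this
        have := Real.add_one_le_exp (1000 * (b : ℝ)); linarith
      calc (l : ℝ) * S * |E| ≤ Real.exp (1000 * b) * Real.exp (-(13000 * (b : ℝ))) := by gcongr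
        _ = Real.exp (-(12000 * b)) := by rw [← Real.exp_add]; ring_nf
        _ ≤ 1 := Real.exp_le_one_iff.mpr (by linarith)
    have hval : ∀ i : Fin l, (β 0 ^ r * (η 0 / d) ^ s) ^ (i : ℕ) =
        Real.exp ((i : ℕ) * (ω * x)) * Real.exp ((i : ℕ) * (s * E)) := by
      intro i
      rw [hE]
      have h1 : β 0 = Real.exp ω := (Real.exp_log hβ0).symm
      rw [h1]
      simp only [← Real.exp_nat_mul, ← Real.exp_add]
      congr 1
      rw [hx]; push_cast; ring
    have hsplit : ∑ i : Fin l, ∑ k : Fin K,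
        (p i k : ℝ) * (x : ℝ) ^ (k : ℕ) * (β 0 ^ r * (η 0 / d) ^ s) ^ (i : ℕ) =
        ∑ i, ∑ k, (p i k : ℝ) * (x : ℝ) ^ (k : ℕ) * Real.exp ((i : ℕ) * (ω * x)) +
        ∑ i, ∑ k, (p i k : ℝ) * (x : ℝ) ^ (k : ℕ) * (Real.exp ((i : ℕ) * (ω * x)) *
          (Real.exp ((i : ℕ) * (s * E)) - 1)) := by
      rw [← Finset.sum_add_distrib]
      refine Finset.sum_congr rfl fun i _ => ?_
      rw [← Finset.sum_add_distrib]
      refine Finset.sum_congr rfl fun k _ => ?_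
      rw [hval]; ring
    rw [hsplit]
    refine (abs_add_le _ _).trans (add_le_add (hpsmall x (Nat.cast_nonneg _) hxX) ?_)
    have hterm : ∀ i : Fin l, ∀ k : Fin K, |(p i k : ℝ) * (x : ℝ) ^ (k : ℕ) *
        (Real.exp ((i : ℕ) * (ω * x)) * (Real.exp ((i : ℕ) * (s * E)) - 1))| ≤
        P * X ^ K * (Real.exp (1002 * b) * (2 * (l * S * |E|))) := by
      intro i k
      have h1 : |(p i k : ℝ)| ≤ P := by exact_mod_cast hpP i k
      have h2 : (x : ℝ) ^ (k : ℕ) ≤ X ^ K :=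
        (pow_le_pow_left₀ (Nat.cast_nonneg _) hxX _).trans (pow_le_pow_right₀ hX1 k.2.le)
      have hil : ((i : ℕ) : ℝ) ≤ l := by exact_mod_cast i.2.le
      have h3 : Real.exp ((i : ℕ) * (ω * x)) ≤ Real.exp (1002 * b) := by
        apply Real.exp_le_exp.mpr
        refine le_trans ?_ hW
        have : ω * x ≤ |ω| * X :=
          mul_le_mul (le_abs_self _) hxX (Nat.cast_nonneg _) (abs_nonneg _)
        calc ((i : ℕ) : ℝ) * (ω * x) ≤ (i : ℕ) * (|ω| * X) := by gcongr
          _ ≤ l * (|ω| * X) := by gcongr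
      have h4 : |((i : ℕ) : ℝ) * (s * E)| ≤ l * S * |E| := by
        rw [abs_mul, abs_mul, Nat.abs_cast, Nat.abs_cast, mul_assoc]
        have : (s : ℝ) ≤ S := by exact_mod_cast hs.le
        gcongr
      have h5 := (Real.abs_exp_sub_one_le (h4.trans hlS)).trans
        (mul_le_mul_of_nonneg_left h4 (by norm_num))
      rw [abs_mul, abs_mul, abs_mul, abs_pow, Nat.abs_cast, Real.abs_exp]
      gcongr
    calc _ ≤ ∑ i : Fin l, ∑ k : Fin K, P * X ^ K * (Real.exp (1002 * b) * (2 * (l * S * |E|))) :=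
          (Finset.abs_sum_le_sum_abs _ _).trans (Finset.sum_le_sum fun i _ =>
            (Finset.abs_sum_le_sum_abs _ _).trans (Finset.sum_le_sum fun k _ => hterm i k))
      _ = _ := by simp; ring
  have hsmall : |F 0| ≤ 3 * Real.exp (-(9068 * b)) := by
    have hKm : (K : ℝ) + (15000 * b : ℕ) ≤ 15001 * b := by
      have : K + 15000 * b ≤ 15001 * b := by omega
      exact_mod_cast this
    have hexpb : (b : ℝ) ≤ Real.exp b := by have := Real.add_one_le_exp (b : ℝ); linarith
    have h1 : (K + (15000 * b : ℕ)) * (2 * Real.exp (1002 * b) / B) ≤ Real.exp (-(11181 * b)) := by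
      calc (K + (15000 * b : ℕ)) * (2 * Real.exp (1002 * b) / B)
          ≤ (15001 * b) * (2 * Real.exp (1002 * b) / Real.exp (12199 * b)) := by gcongr
        _ = (30002 * b) * (Real.exp (1002 * b) / Real.exp (12199 * b)) := by ring
        _ ≤ (Real.exp (15 : ℕ) * Real.exp b) * (Real.exp (1002 * b) / Real.exp (12199 * b)) := by
            gcongr; exact le_exp_of_le_two_pow 15 (by norm_num)
        _ = Real.exp (15 + b + (1002 * b - 12199 * b)) := by
            rw [← Real.exp_sub, ← Real.exp_add, ← Real.exp_add]; norm_num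
        _ ≤ _ := Real.exp_le_exp.mpr (by linarith)
    have h2 : Real.exp (3 * (1002 * b) - (15000 * b : ℕ)) ≤ Real.exp (-(11181 * b)) :=
      Real.exp_le_exp.mpr (by push_cast; linarith)
    have h3 : Real.exp (1002 * b) * (2 * (l * S * |E|)) ≤ Real.exp (-(11181 * b)) := by
      have h4 : (l : ℝ) * S ≤ 1000 * b := by
        have : l * S ≤ 1000 * b := by
          calc l * S = 1000 * (l ^ 2 * h₁ * 1) := by rw [hS]; ring
            _ ≤ 1000 * b := by rw [hb]; gcongr; omega
        exact_mod_cast this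
      calc Real.exp (1002 * b) * (2 * (l * S * |E|))
          ≤ Real.exp (1002 * b) * (2 * (1000 * b * Real.exp (-(13000 * (b : ℝ))))) := by gcongr
        _ = (2000 * b) * (Real.exp (1002 * b) * Real.exp (-(13000 * (b : ℝ)))) := by ring
        _ ≤ (Real.exp (11 : ℕ) * Real.exp b) *
            (Real.exp (1002 * b) * Real.exp (-(13000 * (b : ℝ)))) := by
            gcongr; exact le_exp_of_le_two_pow 11 (by norm_num)
        _ = Real.exp (11 + b + (1002 * b - 13000 * b)) := by
            rw [← Real.exp_add, ← Real.exp_add, ← Real.exp_add]; norm_num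
            ring_nf
        _ ≤ _ := Real.exp_le_exp.mpr (by linarith)
    have hdS : (d : ℝ) ^ (l * S) ≤ Real.exp (1000 * b) := by
      calc (d : ℝ) ^ (l * S) ≤ Real.exp h₂ ^ (l * S) := by gcongr
        _ = Real.exp (1000 * b) := by
            rw [← Real.exp_nat_mul]; congr 1; rw [hS, hb]; push_cast; ring
    rw [hF0eq, abs_mul, abs_of_pos (by positivity : 0 < (d : ℝ) ^ (l * S))]
    calc _ ≤ Real.exp (1000 * b) * (Real.exp (1021 * b) *
          (Real.exp (-(11181 * b)) + Real.exp (-(11181 * b))) +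
          Real.exp (1021 * b) * Real.exp (-(11181 * b))) := by
          refine mul_le_mul hdS (hsum.trans ?_) (abs_nonneg _) (Real.exp_pos _).le
          gcongr
      _ = 3 * (Real.exp (1000 * b) * Real.exp (1021 * b) * Real.exp (-(11181 * b))) := by ring
      _ = 3 * Real.exp (-(9160 * b)) := by
          rw [← Real.exp_add, ← Real.exp_add]; ring_nf
      _ ≤ _ := by gcongr; norm_num
  have hlt : ∏ i, |F i| < 1 := by
    rw [Fin.prod_univ_four]
    calc |F 0| * |F 1| * |F 2| * |F 3|
        ≤ 3 * Real.exp (-(9068 * b)) * Real.exp (3022 * b) * Real.exp (3022 * b) *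
          Real.exp (3022 * b) := by
          gcongr <;> exact hconj _
      _ = 3 * Real.exp (-(2 * b)) := by
          rw [mul_assoc, mul_assoc, mul_assoc, ← Real.exp_add, ← Real.exp_add, ← Real.exp_add]
          ring_nf
      _ ≤ 3 * Real.exp (-2) := by gcongr; linarith
      _ < 1 := by
          have h1 : (4 : ℝ) < Real.exp 2 := by
            have h3 := Real.exp_one_gt_d9
            have h2 : Real.exp 2 = Real.exp 1 * Real.exp 1 := by
              rw [← Real.exp_add]; norm_num
            rw [h2]; nlinarith
          rw [Real.exp_neg, ← div_eq_mul_inv, div_lt_one (Real.exp_pos _)]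
          linarith
  linarith

theorem exists_card_divisors_le_mul_rpow {δ : ℝ} (hδ : 0 < δ) :
    ∃ C : ℝ, 1 ≤ C ∧ ∀ n : ℕ, n ≠ 0 → (n.divisors.card : ℝ) ≤ C * (n : ℝ) ^ δ := by
  obtain ⟨B, hB⟩ := exists_nat_ge ((2 : ℝ) ^ (1 / δ))
  have hlog2 : 0 < Real.log 2 := Real.log_pos (by norm_num)
  set L : ℝ := 1 + 1 / (δ * Real.log 2) with hL
  have hL1 : 1 ≤ L := by
    have : 0 < 1 / (δ * Real.log 2) := by positivity
    linarith
  refine ⟨L ^ B, one_le_pow₀ hL1, fun n hn => ?_⟩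
  have hterm : ∀ p ∈ n.primeFactors, ((n.factorization p : ℝ) + 1) ≤
      (if p < B then L else 1) * ((p : ℝ) ^ n.factorization p) ^ δ := by
    intro p hp
    have hp2 : (2 : ℝ) ≤ p := by exact_mod_cast (Nat.prime_of_mem_primeFactors hp).two_le
    set e := n.factorization p
    rw [← Real.rpow_natCast, ← Real.rpow_mul (by linarith), mul_comm (e : ℝ) δ]
    split_ifs with h
    · have h1 : 1 + δ * Real.log 2 * e ≤ (p : ℝ) ^ (δ * e) := by
        calc 1 + δ * Real.log 2 * e ≤ Real.exp (Real.log 2 * (δ * e)) := by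
              have := Real.add_one_le_exp (Real.log 2 * (δ * e)); linarith
          _ = (2 : ℝ) ^ (δ * e) := by rw [Real.rpow_def_of_pos (by norm_num)]
          _ ≤ _ := Real.rpow_le_rpow (by norm_num) hp2 (by positivity)
      calc (e : ℝ) + 1 ≤ L * (1 + δ * Real.log 2 * e) := by
            have h2 : 0 < δ * Real.log 2 := by positivity
            rw [hL]
            have h3 : (1 + 1 / (δ * Real.log 2)) * (1 + δ * Real.log 2 * e) =
              e + 1 + (δ * Real.log 2 * e + 1 / (δ * Real.log 2)) := by field_simp; ring
            rw [h3]
            have : 0 ≤ δ * Real.log 2 * e + 1 / (δ * Real.log 2) := by positivity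
            linarith
        _ ≤ _ := by gcongr
    · have h1 : (2 : ℝ) ≤ (p : ℝ) ^ δ := by
        have h2 : (2 : ℝ) ^ (1 / δ) ≤ p := hB.trans (by exact_mod_cast not_lt.mp h)
        calc (2 : ℝ) = ((2 : ℝ) ^ (1 / δ)) ^ δ := by
              rw [← Real.rpow_mul (by norm_num)]; field_simp; simp
          _ ≤ _ := Real.rpow_le_rpow (by positivity) h2 hδ.le
      rw [one_mul, Real.rpow_mul (by linarith), Real.rpow_natCast]
      calc (e : ℝ) + 1 ≤ 2 ^ e := by exact_mod_cast Nat.lt_two_pow_self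
        _ ≤ _ := by gcongr
  rw [Nat.card_divisors hn]
  push_cast
  calc ∏ p ∈ n.primeFactors, ((n.factorization p : ℝ) + 1)
      ≤ ∏ p ∈ n.primeFactors, ((if p < B then L else 1) * ((p : ℝ) ^ n.factorization p) ^ δ) :=
        Finset.prod_le_prod (fun _ _ => by positivity) hterm
    _ = L ^ (n.primeFactors.filter (· < B)).card * (n : ℝ) ^ δ := by
        rw [Finset.prod_mul_distrib, Real.finsetProd_rpow _ _ (fun _ _ => by positivity)]
        congr 1
        · rw [Finset.prod_ite]; simp
        · congr 1
          conv_rhs => rw [← Nat.prod_factorization_pow_eq_self hn]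
          rw [Finsupp.prod]; push_cast; rfl
    _ ≤ L ^ B * (n : ℝ) ^ δ := by
        gcongr
        calc (n.primeFactors.filter (· < B)).card ≤ (Finset.range B).card :=
              Finset.card_le_card fun p hp => by simp at hp; simp [hp.2]
          _ = B := Finset.card_range B

theorem exists_coprime_small_norm {D : ℕ} (hD : ¬ IsSquare D) {Q : ℕ} (hQ : 0 < Q) :
    ∃ x y : ℤ, 0 < x ∧ 0 < y ∧ IsCoprime x y ∧ |(x : ℝ) - y * √D| < 1 / Q ∧
      (x : ℝ) + y * √D ≤ 3 * √D * Q ∧ |((x ^ 2 - D * y ^ 2 : ℤ) : ℝ)| ≤ 2 * √D + 1 ∧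
      x ^ 2 - D * y ^ 2 ≠ 0 := by
  have hD2 : 2 ≤ D := by
    by_contra h
    interval_cases D <;> simp at hD
  have hs1 : 1 < √(D : ℝ) := by
    rw [Real.lt_sqrt (by norm_num)]; norm_num; exact_mod_cast hD2
  have hss : √(D : ℝ) ^ 2 = D := Real.sq_sqrt (Nat.cast_nonneg _)
  set s := √(D : ℝ)
  obtain ⟨r, hr, hrQ⟩ := Real.exists_rat_abs_sub_le_and_den_le s hQ
  have hyp : (0 : ℝ) < r.den := by exact_mod_cast r.den_pos
  have hy1 : (1 : ℝ) ≤ r.den := by exact_mod_cast r.den_pos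
  have hQR : (0 : ℝ) < Q := by exact_mod_cast hQ
  have hQ1 : (1 : ℝ) ≤ Q := by exact_mod_cast hQ
  have hyQ : (r.den : ℝ) ≤ Q := by exact_mod_cast hrQ
  have hsmall : |(r.num : ℝ) - r.den * s| ≤ 1 / (Q + 1) := by
    have h1 : (r.num : ℝ) - r.den * s = -((s - r) * r.den) := by
      have : (r : ℝ) = r.num / r.den := by exact_mod_cast (Rat.num_div_den r).symm
      rw [this]; field_simp; ring
    rw [h1, abs_neg, abs_mul, abs_of_pos hyp]
    calc |s - r| * r.den ≤ 1 / ((Q + 1) * r.den) * r.den := by gcongr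
      _ = _ := by field_simp
  have hlt : 1 / ((Q : ℝ) + 1) < 1 / Q := by gcongr; linarith
  have hle : 1 / ((Q : ℝ) + 1) ≤ 1 := by rw [div_le_one (by positivity)]; linarith
  have hab := abs_le.mp hsmall
  have hys : s ≤ r.den * s := by nlinarith
  have hyQs : r.den * s ≤ Q * s := by gcongr
  refine ⟨r.num, r.den, ?_, by exact_mod_cast r.den_pos, ?_, ?_, ?_, ?_, ?_⟩
  · have : (0 : ℝ) < r.num := by linarith [hab.1]
    exact_mod_cast this
  · rw [Int.isCoprime_iff_nat_coprime]; simpa using r.reduced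
  · exact_mod_cast hsmall.trans_lt hlt
  · push_cast
    have : 1 ≤ s * Q := by nlinarith
    linarith [hab.2]
  · push_cast
    rw [← hss, show (r.num : ℝ) ^ 2 - s ^ 2 * r.den ^ 2 =
      (r.num - r.den * s) * ((r.num - r.den * s) + 2 * (r.den * s)) by ring, abs_mul]
    calc |(r.num : ℝ) - r.den * s| * |(r.num - r.den * s) + 2 * (r.den * s)|
        ≤ 1 / (Q + 1) * (1 + 2 * (Q * s)) := by
          gcongr
          refine (abs_add_le _ _).trans ?_
          rw [abs_of_nonneg (by positivity : (0 : ℝ) ≤ 2 * (r.den * s))]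
          linarith
      _ ≤ 2 * s + 1 := by
          rw [one_div, inv_mul_le_iff₀ (by positivity)]
          nlinarith
  · intro h
    apply hD
    have h2 : ((r.den : ℤ)) ^ 2 ∣ r.num ^ 2 := ⟨D, by linarith⟩
    have h3 : (r.den : ℤ) ∣ r.num := (Int.pow_dvd_pow_iff (by norm_num)).mp h2
    obtain ⟨c, hc⟩ := h3
    have h4 : (D : ℤ) = c * c := by
      have h5 : (r.den : ℤ) ^ 2 * (c * c - D) = 0 := by rw [hc] at h; linarith
      have : (r.den : ℤ) ^ 2 ≠ 0 := by positivity
      have := (mul_eq_zero.mp h5).resolve_left this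
      linarith
    exact Int.isSquare_natCast_iff.mp ⟨c, h4⟩

theorem exists_residue_of_coprime {D x y : ℤ} (h : IsCoprime x y) (hm : x ^ 2 - D * y ^ 2 ≠ 0) :
    ∃ t : ℕ, (t : ℤ) < |x ^ 2 - D * y ^ 2| ∧ (x ^ 2 - D * y ^ 2) ∣ t * y - x ∧
      (x ^ 2 - D * y ^ 2) ∣ (t : ℤ) ^ 2 - D := by
  set m := x ^ 2 - D * y ^ 2 with hmdef
  have hc : IsCoprime y m := by
    have h1 : IsCoprime y (x ^ 2 + y * (-(D * y))) := (h.symm.pow_right).add_mul_left_right _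
    convert h1 using 1; rw [hmdef]; ring
  obtain ⟨u, v, huv⟩ := hc
  have ht := Int.emod_nonneg (x * u) hm
  refine ⟨((x * u) % m).toNat, ?_, ?_⟩
  · rw [Int.toNat_of_nonneg ht]; exact Int.emod_lt_abs _ hm
  rw [Int.toNat_of_nonneg ht]
  have hdvd : m ∣ (x * u) % m * y - x := by
    refine ⟨-(y * (x * u / m)) - x * v, ?_⟩
    have h1 := Int.emod_add_mul_ediv (x * u) m
    linear_combination y * h1 + x * huv
  refine ⟨hdvd, ?_⟩
  have h2 : m ∣ (((x * u) % m) ^ 2 - D) * y ^ 2 := by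
    obtain ⟨k, hk⟩ := hdvd
    refine ⟨k * ((x * u) % m * y + x) + 1, ?_⟩
    linear_combination ((x * u) % m * y + x) * hk - hmdef
  exact (IsCoprime.pow_right (⟨v, u, by linarith⟩ : IsCoprime m y)).dvd_of_dvd_mul_right h2

theorem pell_of_same_residue {D x₁ y₁ x₂ y₂ m : ℤ} {t : ℤ} (hm : m ≠ 0)
    (h₁ : x₁ ^ 2 - D * y₁ ^ 2 = m) (h₂ : x₂ ^ 2 - D * y₂ ^ 2 = m) (ht₁ : m ∣ t * y₁ - x₁)
    (ht₂ : m ∣ t * y₂ - x₂) (ht : m ∣ t ^ 2 - D) :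
    ∃ x y : ℤ, x ^ 2 - D * y ^ 2 = 1 ∧ m * x = x₁ * x₂ - D * (y₁ * y₂) ∧
      m * y = x₂ * y₁ - x₁ * y₂ := by
  obtain ⟨k₁, hk₁⟩ := ht₁
  obtain ⟨k₂, hk₂⟩ := ht₂
  obtain ⟨k, hk⟩ := ht
  obtain rfl : x₁ = t * y₁ - m * k₁ := by linarith
  obtain rfl : x₂ = t * y₂ - m * k₂ := by linarith
  refine ⟨k * y₁ * y₂ - k₁ * t * y₂ - k₂ * t * y₁ + m * k₁ * k₂, y₂ * k₁ - k₂ * y₁, ?_, ?_, ?_⟩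
  · have hm2 : m ^ 2 ≠ 0 := by positivity
    apply mul_left_cancel₀ hm2
    have e1 : m * (k * y₁ * y₂ - k₁ * t * y₂ - k₂ * t * y₁ + m * k₁ * k₂) =
      (t * y₁ - m * k₁) * (t * y₂ - m * k₂) - D * (y₁ * y₂) := by
      linear_combination -(y₁ * y₂) * hk
    calc _ = (m * (k * y₁ * y₂ - k₁ * t * y₂ - k₂ * t * y₁ + m * k₁ * k₂)) ^ 2 -
          D * (m * (y₂ * k₁ - k₂ * y₁)) ^ 2 := by ring
      _ = ((t * y₁ - m * k₁) ^ 2 - D * y₁ ^ 2) * ((t * y₂ - m * k₂) ^ 2 - D * y₂ ^ 2) := by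
          rw [e1]; ring
      _ = m ^ 2 * 1 := by rw [h₁, h₂]; ring
  · linear_combination -(y₁ * y₂) * hk
  · ring

theorem card_residue_keys_le {δ C : ℝ} (hδ : 0 < δ) (hC : 1 ≤ C)
    (hdiv : ∀ n : ℕ, n ≠ 0 → (n.divisors.card : ℝ) ≤ C * (n : ℝ) ^ δ) {D : ℕ} (hD0 : 0 < D)
    (hD : ¬ IsSquare D) :
    ((((Finset.range ⌈2 * √(D : ℝ) + 1⌉₊).sigma fun t =>
      ((t : ℤ) ^ 2 - D).natAbs.divisors ×ˢ (Finset.univ : Finset Bool)).card : ℕ) : ℝ) ≤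
      8 * 16 ^ δ * C * (D : ℝ) ^ (1 / 2 + δ) := by
  have hDR : (1 : ℝ) ≤ D := by exact_mod_cast hD0
  have hs1 : 1 ≤ √(D : ℝ) := Real.one_le_sqrt.mpr hDR
  have hss : √(D : ℝ) ^ 2 = D := Real.sq_sqrt (Nat.cast_nonneg _)
  have hM : ((⌈2 * √(D : ℝ) + 1⌉₊ : ℕ) : ℝ) ≤ 4 * √(D : ℝ) := by
    have := Nat.ceil_lt_add_one (by positivity : 0 ≤ 2 * √(D : ℝ) + 1)
    linarith
  set M := ⌈2 * √(D : ℝ) + 1⌉₊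
  rw [Finset.card_sigma]
  push_cast
  have hterm : ∀ t ∈ Finset.range M, ((((t : ℤ) ^ 2 - D).natAbs.divisors ×ˢ
      (Finset.univ : Finset Bool)).card : ℝ) ≤ 2 * (C * (16 ^ δ * (D : ℝ) ^ δ)) := by
    intro t ht
    have htM : (t : ℝ) ≤ 4 * √(D : ℝ) :=
      le_trans (by exact_mod_cast (Finset.mem_range.mp ht).le) hM
    have hne : ((t : ℤ) ^ 2 - D).natAbs ≠ 0 := by
      intro h
      apply hD
      have h1 : (D : ℤ) = t * t := by
        have := Int.natAbs_eq_zero.mp h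
        linarith
      exact ⟨t, by exact_mod_cast h1⟩
    have habs : (((t : ℤ) ^ 2 - D).natAbs : ℝ) ≤ 16 * D := by
      rw [Nat.cast_natAbs]
      push_cast
      rw [abs_le]
      constructor
      · nlinarith [sq_nonneg (t : ℝ)]
      · have : (t : ℝ) ^ 2 ≤ (4 * √(D : ℝ)) ^ 2 := by gcongr
        rw [mul_pow, hss] at this
        linarith
    rw [Finset.card_product]
    simp only [Finset.card_univ, Fintype.card_bool, Nat.cast_mul, Nat.cast_ofNat]
    rw [mul_comm, ← Real.mul_rpow (by norm_num) (by positivity)]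
    have := hdiv _ hne
    gcongr
    exact this.trans (by gcongr)
  refine (Finset.sum_le_sum hterm).trans ?_
  rw [Finset.sum_const, Finset.card_range, nsmul_eq_mul, Real.rpow_add (by linarith),
    ← Real.sqrt_eq_rpow]
  calc (M : ℝ) * (2 * (C * (16 ^ δ * (D : ℝ) ^ δ)))
      ≤ 4 * √(D : ℝ) * (2 * (C * (16 ^ δ * (D : ℝ) ^ δ))) := by gcongr
    _ = _ := by ring

/-- A nontrivial solution of Pell's equation whose logarithm is nearly `√D`. -/
theorem exists_pell_log_le {δ : ℝ} (hδ : 0 < δ) :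
    ∃ C : ℝ, 1 ≤ C ∧ ∀ D : ℕ, ¬ IsSquare D → ∃ x y : ℕ, 0 < x ∧ 0 < y ∧ x ^ 2 = D * y ^ 2 + 1 ∧
      Real.log (x + y * √(D : ℝ)) ≤ C * (D : ℝ) ^ (1 / 2 + δ) := by
  obtain ⟨C, hC, hdiv⟩ := exists_card_divisors_le_mul_rpow (half_pos hδ)
  set C' : ℝ := 8 * 16 ^ (δ / 2) * C with hC'
  have h16 : (1 : ℝ) ≤ 16 ^ (δ / 2) := Real.one_le_rpow (by norm_num) (by positivity)
  have hC'1 : 1 ≤ C' := by rw [hC']; nlinarith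
  refine ⟨max 1 (4 * C' * (3 ^ (δ / 2) / (δ / 2))), le_max_left _ _, fun D hD => ?_⟩
  have hD2 : 2 ≤ D := by
    by_contra h
    interval_cases D <;> simp at hD
  have hDR : (2 : ℝ) ≤ D := by exact_mod_cast hD2
  have hkeys := card_residue_keys_le (half_pos hδ) hC hdiv (by omega) hD
  have hs1 : 1 ≤ √(D : ℝ) := Real.one_le_sqrt.mpr (by linarith)
  have hss : √(D : ℝ) ^ 2 = D := Real.sq_sqrt (Nat.cast_nonneg _)
  have hsD : √(D : ℝ) ≤ D := by nlinarith
  set s := √(D : ℝ) with hs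
  set B : ℝ := 8 * 16 ^ (δ / 2) * C * (D : ℝ) ^ (1 / 2 + δ / 2) with hB
  have hB1 : 1 ≤ B := by
    rw [hB, ← hC']
    have : (1 : ℝ) ≤ (D : ℝ) ^ (1 / 2 + δ / 2) := Real.one_le_rpow (by linarith) (by positivity)
    nlinarith
  set J : ℕ := ⌊B⌋₊ + 1 with hJ
  have hJB : (J : ℝ) ≤ 2 * B := by
    rw [hJ]; push_cast
    have := Nat.floor_le (by linarith : 0 ≤ B)
    linarith
  have hBJ : B < J := by rw [hJ]; push_cast; exact Nat.lt_floor_add_one B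
  have hGpos : ∀ j : ℕ, 0 < (3 * D) ^ j := fun j => by positivity
  choose X Y hX hY hcop hclose hsize hnorm hnz using
    fun j : ℕ => exists_coprime_small_norm hD (hGpos j)
  choose t htlt htdvd htD using fun j : ℕ => exists_residue_of_coprime (hcop j) (hnz j)
  set m : ℕ → ℤ := fun j => X j ^ 2 - D * Y j ^ 2 with hm
  obtain ⟨i, hi, j, hj, hij, hkey⟩ := Finset.exists_ne_map_eq_of_card_lt_of_maps_to
    (s := Finset.range J) (t := (Finset.range ⌈2 * s + 1⌉₊).sigma fun t =>
      ((t : ℤ) ^ 2 - D).natAbs.divisors ×ˢ (Finset.univ : Finset Bool))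
    (f := fun j => (⟨t j, (m j).natAbs, decide (0 < m j)⟩ : Σ _ : ℕ, ℕ × Bool))
    (by
      have := hkeys.trans_lt hBJ
      rw [Finset.card_range]
      exact_mod_cast this)
    (by
      intro j _
      simp only [Finset.coe_sigma, Set.mem_sigma_iff, Finset.mem_coe, Finset.mem_range,
        Finset.mem_product, Nat.mem_divisors, Finset.mem_univ, and_true]
      refine ⟨?_, Int.natAbs_dvd_natAbs.mpr (htD j), ?_⟩
      · have h1 : ((t j : ℤ) : ℝ) < |((m j : ℤ) : ℝ)| := by exact_mod_cast htlt j
        have h2 := (h1.trans_le (hnorm j)).trans_le (Nat.le_ceil _)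
        exact_mod_cast h2
      · intro h
        apply hD
        have h1 : (D : ℤ) = t j * t j := by
          have := Int.natAbs_eq_zero.mp h
          linarith
        exact ⟨t j, by exact_mod_cast h1⟩)
  obtain ⟨htij, hmij⟩ : t i = t j ∧ m i = m j := by
    simp only [Sigma.mk.injEq, heq_eq_eq, Prod.mk.injEq, decide_eq_decide] at hkey
    obtain ⟨h1, h2, h3⟩ := hkey
    refine ⟨h1, ?_⟩
    have hi0 : m i ≠ 0 := hnz i
    have hj0 : m j ≠ 0 := hnz j
    omega
  have hG1 : (1 : ℝ) ≤ 3 * D := by linarith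
  have hsize' : ∀ j : ℕ, (X j : ℝ) + Y j * s ≤ (3 * D : ℝ) ^ (j + 1) := by
    intro j
    refine (hsize j).trans ?_
    push_cast
    rw [pow_succ, mul_comm]
    gcongr
  have hXR : ∀ j, (0 : ℝ) < X j := fun j => by exact_mod_cast hX j
  have hYR : ∀ j, (0 : ℝ) < Y j := fun j => by exact_mod_cast hY j
  have hanti : ∀ i j : ℕ, i < j → |(X j : ℝ) - Y j * s| < |(X i : ℝ) - Y i * s| := by
    intro i j hij
    have hpos : 0 < (X i : ℝ) + Y i * s := by have := hXR i; have := hYR i; positivity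
    have h1 : (1 : ℝ) ≤ |(X i : ℝ) - Y i * s| * (X i + Y i * s) := by
      rw [← abs_of_pos hpos, ← abs_mul]
      have h2 : ((X i : ℝ) - Y i * s) * (X i + Y i * s) = ((m i : ℤ) : ℝ) := by
        simp only [hm]; push_cast; rw [← hss]; ring
      rw [h2]
      exact_mod_cast Int.one_le_abs (hnz i)
    refine (hclose j).trans_le ?_
    rw [div_le_iff₀ (by exact_mod_cast hGpos j)]
    refine h1.trans ?_
    gcongr
    refine (hsize' i).trans ?_
    push_cast
    exact pow_le_pow_right₀ hG1 hij
  obtain ⟨x, y, hxy, hx, hy⟩ := pell_of_same_residue (D := D) (hnz i) rfl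
    (show X j ^ 2 - D * Y j ^ 2 = m i from hmij.symm) (htdvd i)
    (show m i ∣ t i * Y j - X j by rw [htij, hmij]; exact htdvd j) (htD i)
  have hmi1 : (1 : ℤ) ≤ |m i| := Int.one_le_abs (hnz i)
  have hy0 : y ≠ 0 := by
    intro h0
    have hXY : X j * Y i = X i * Y j := by rw [h0] at hy; linarith
    have hsq : (X j : ℝ) ^ 2 = X i ^ 2 ∧ (Y j : ℝ) ^ 2 = Y i ^ 2 := by
      have h2 : Y i ^ 2 * m j = Y j ^ 2 * m i := by
        simp only [hm]
        linear_combination (X j * Y i + X i * Y j) * hXY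
      rw [hmij] at h2
      have h3 : Y i ^ 2 = Y j ^ 2 := mul_right_cancel₀ (hnz j) h2
      have h4 : X j ^ 2 = X i ^ 2 := by
        have := hmij
        simp only [hm] at this
        rw [h3] at this
        linarith
      exact ⟨by exact_mod_cast h4, by exact_mod_cast h3.symm⟩
    have e1 := (pow_left_inj₀ (hXR j).le (hXR i).le two_ne_zero).mp hsq.1
    have e2 := (pow_left_inj₀ (hYR j).le (hYR i).le two_ne_zero).mp hsq.2
    rcases lt_or_gt_of_ne hij with h | h
    · exact (hanti i j h).ne (by rw [e1, e2])
    · exact (hanti j i h).ne (by rw [e1, e2])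
  have hx0 : x ≠ 0 := by
    rintro rfl
    nlinarith [sq_nonneg y]
  refine ⟨x.natAbs, y.natAbs, Int.natAbs_pos.mpr hx0, Int.natAbs_pos.mpr hy0, ?_, ?_⟩
  · zify; rw [sq_abs, sq_abs]; linarith
  have hmR : (1 : ℝ) ≤ |((m i : ℤ) : ℝ)| := by exact_mod_cast hmi1
  have hxb : (x.natAbs : ℝ) ≤ X i * X j + D * (Y i * Y j) := by
    rw [Nat.cast_natAbs]; push_cast
    have h1 : ((m i : ℤ) : ℝ) * x = X i * X j - D * (Y i * Y j) := by exact_mod_cast hx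
    calc |(x : ℝ)| ≤ |((m i : ℤ) : ℝ)| * |(x : ℝ)| := le_mul_of_one_le_left (abs_nonneg _) hmR
      _ = |(X i : ℝ) * X j - D * (Y i * Y j)| := by rw [← abs_mul, h1]
      _ ≤ _ := by
        have := hXR i; have := hXR j; have := hYR i; have := hYR j
        rw [abs_le]
        have : 0 < (X i : ℝ) * X j := by positivity
        have : 0 < (D : ℝ) * (Y i * Y j) := by positivity
        constructor <;> linarith
  have hyb : (y.natAbs : ℝ) ≤ X j * Y i + X i * Y j := by
    rw [Nat.cast_natAbs]; push_cast
    have h1 : ((m i : ℤ) : ℝ) * y = X j * Y i - X i * Y j := by exact_mod_cast hy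
    calc |(y : ℝ)| ≤ |((m i : ℤ) : ℝ)| * |(y : ℝ)| := le_mul_of_one_le_left (abs_nonneg _) hmR
      _ = |(X j : ℝ) * Y i - X i * Y j| := by rw [← abs_mul, h1]
      _ ≤ _ := by
        have := hXR i; have := hXR j; have := hYR i; have := hYR j
        rw [abs_le]
        have : 0 < (X j : ℝ) * Y i := by positivity
        have : 0 < (X i : ℝ) * Y j := by positivity
        constructor <;> linarith
  have hJ' : ∀ k ∈ Finset.range J, (X k : ℝ) + Y k * s ≤ (3 * D : ℝ) ^ J := fun k hk =>
    (hsize' k).trans (pow_le_pow_right₀ hG1 (Finset.mem_range.mp hk))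
  have htot : (x.natAbs : ℝ) + y.natAbs * s ≤ (3 * D : ℝ) ^ (2 * J) := by
    calc (x.natAbs : ℝ) + y.natAbs * s
        ≤ (X i * X j + D * (Y i * Y j)) + (X j * Y i + X i * Y j) * s := by gcongr
      _ = (X i + Y i * s) * (X j + Y j * s) := by rw [← hss]; ring
      _ ≤ (3 * D : ℝ) ^ J * (3 * D : ℝ) ^ J := by
        have := hXR j; have := hYR j
        exact mul_le_mul (hJ' i hi) (hJ' j hj) (by positivity) (by positivity)
      _ = _ := by rw [two_mul]; exact (pow_add _ J J).symm
  have hpos : (0 : ℝ) < x.natAbs + y.natAbs * s := by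
    have : (0 : ℝ) < x.natAbs := by exact_mod_cast Int.natAbs_pos.mpr hx0
    positivity
  calc Real.log (x.natAbs + y.natAbs * s) ≤ Real.log ((3 * D : ℝ) ^ (2 * J)) :=
        Real.log_le_log hpos htot
    _ = 2 * J * Real.log (3 * D) := by rw [Real.log_pow]; push_cast; ring
    _ ≤ 2 * (2 * B) * ((3 * D : ℝ) ^ (δ / 2) / (δ / 2)) := by
        gcongr
        · exact Real.log_nonneg hG1
        · exact Real.log_le_rpow_div (by positivity) (half_pos hδ)
    _ = 4 * C' * (3 ^ (δ / 2) / (δ / 2)) * (D : ℝ) ^ (1 / 2 + δ) := by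
        have e : (1 / 2 + δ : ℝ) = (1 / 2 + δ / 2) + δ / 2 := by ring
        rw [Real.mul_rpow (by norm_num) (by positivity), e, Real.rpow_add (by linarith), hB, hC']
        ring
    _ ≤ _ := by gcongr; exact le_max_right _ _

theorem eq_zero_of_sq_eq_mul_sq {D : ℕ} (hD : ¬ IsSquare D) {x y : ℤ} (h : x ^ 2 = D * y ^ 2) :
    x = 0 ∧ y = 0 := by
  have hy : y = 0 := by
    by_contra hy
    have h3 : y ∣ x := (Int.pow_dvd_pow_iff two_ne_zero).mp ⟨D, by linarith⟩
    obtain ⟨c, rfl⟩ := h3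
    have h5 : y ^ 2 * (c * c - D) = 0 := by linarith
    have := (mul_eq_zero.mp h5).resolve_left (by positivity)
    exact hD (Int.isSquare_natCast_iff.mp ⟨c, by linarith⟩)
  subst hy
  simpa using h

/-- The ring `ℤ[√D₁, √D₂]`, embedded in `ℝ⁴` through its four conjugation maps. -/
noncomputable def biquadraticRing (D₁ D₂ : ℕ) : Subring (Fin 4 → ℝ) where
  carrier := {v | ∃ a b c d : ℤ,
    v 0 = a + b * √(D₁ : ℝ) + c * √(D₂ : ℝ) + d * (√(D₁ : ℝ) * √(D₂ : ℝ)) ∧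
    v 1 = a - b * √(D₁ : ℝ) + c * √(D₂ : ℝ) - d * (√(D₁ : ℝ) * √(D₂ : ℝ)) ∧
    v 2 = a + b * √(D₁ : ℝ) - c * √(D₂ : ℝ) - d * (√(D₁ : ℝ) * √(D₂ : ℝ)) ∧
    v 3 = a - b * √(D₁ : ℝ) - c * √(D₂ : ℝ) + d * (√(D₁ : ℝ) * √(D₂ : ℝ))}
  zero_mem' := ⟨0, 0, 0, 0, by simp⟩
  one_mem' := ⟨1, 0, 0, 0, by simp⟩
  add_mem' := by
    rintro v w ⟨a, b, c, d, h0, h1, h2, h3⟩ ⟨a', b', c', d', h0', h1', h2', h3'⟩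
    refine ⟨a + a', b + b', c + c', d + d', ?_⟩
    simp only [Pi.add_apply, h0, h1, h2, h3, h0', h1', h2', h3']
    push_cast
    refine ⟨?_, ?_, ?_, ?_⟩ <;> ring
  neg_mem' := by
    rintro v ⟨a, b, c, d, h0, h1, h2, h3⟩
    refine ⟨-a, -b, -c, -d, ?_⟩
    simp only [Pi.neg_apply, h0, h1, h2, h3]
    push_cast
    refine ⟨?_, ?_, ?_, ?_⟩ <;> ring
  mul_mem' := by
    rintro v w ⟨a, b, c, d, h0, h1, h2, h3⟩ ⟨a', b', c', d', h0', h1', h2', h3'⟩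
    have e1 : √(D₁ : ℝ) ^ 2 = D₁ := Real.sq_sqrt (Nat.cast_nonneg _)
    have e2 : √(D₂ : ℝ) ^ 2 = D₂ := Real.sq_sqrt (Nat.cast_nonneg _)
    refine ⟨a * a' + D₁ * (b * b') + D₂ * (c * c') + D₁ * D₂ * (d * d'),
      a * b' + b * a' + D₂ * (c * d' + d * c'), a * c' + c * a' + D₁ * (b * d' + d * b'),
      a * d' + d * a' + b * c' + c * b', ?_⟩
    simp only [Pi.mul_apply, h0, h1, h2, h3, h0', h1', h2', h3']
    push_cast
    generalize √(D₁ : ℝ) = s at e1 ⊢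
    generalize √(D₂ : ℝ) = t at e2 ⊢
    rw [← e1, ← e2]
    refine ⟨?_, ?_, ?_, ?_⟩ <;> ring

theorem one_le_prod_abs_of_mem_biquadraticRing {D₁ D₂ : ℕ} (h₁ : ¬ IsSquare D₁)
    (h₂ : ¬ IsSquare D₂) (h₁₂ : ¬ IsSquare (D₁ * D₂)) {v : Fin 4 → ℝ}
    (hv : v ∈ biquadraticRing D₁ D₂) (h0 : v ≠ 0) : 1 ≤ ∏ i, |v i| := by
  obtain ⟨a, b, c, d, e0, e1, e2, e3⟩ := hv
  have s1 : √(D₁ : ℝ) ^ 2 = D₁ := Real.sq_sqrt (Nat.cast_nonneg _)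
  have s2 : √(D₂ : ℝ) ^ 2 = D₂ := Real.sq_sqrt (Nat.cast_nonneg _)
  set p : ℤ := a ^ 2 + D₂ * c ^ 2 - D₁ * (b ^ 2 + D₂ * d ^ 2) with hp
  set q : ℤ := 2 * (a * c - D₁ * (b * d)) with hq
  have hprod : ∏ i, |v i| = |((p ^ 2 - D₂ * q ^ 2 : ℤ) : ℝ)| := by
    rw [← Finset.abs_prod]
    congr 1
    rw [Fin.prod_univ_four, e0, e1, e2, e3, hp, hq]
    push_cast
    generalize √(D₁ : ℝ) = s at s1 ⊢
    generalize √(D₂ : ℝ) = t at s2 ⊢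
    rw [← s1, ← s2]
    ring
  rw [hprod]
  have hne : p ^ 2 - D₂ * q ^ 2 ≠ 0 := by
    intro h
    obtain ⟨hp0, hq0⟩ := eq_zero_of_sq_eq_mul_sq h₂ (show p ^ 2 = D₂ * q ^ 2 by linarith)
    have hac : a * c = D₁ * (b * d) := by rw [hq] at hq0; linarith
    rw [hp] at hp0
    have hD₁ : (D₁ : ℤ) ≠ 0 := by rintro h; apply h₁; simp [Int.natCast_eq_zero.mp h]
    have hD₂ : (D₂ : ℤ) ≠ 0 := by rintro h; apply h₂; simp [Int.natCast_eq_zero.mp h]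
    have hfac : (a ^ 2 - D₁ * b ^ 2) * (a ^ 2 - (D₁ * D₂ : ℕ) * d ^ 2) = 0 := by
      push_cast
      linear_combination a ^ 2 * hp0 - D₂ * (a * c + D₁ * (b * d)) * hac
    have hall : a = 0 ∧ b = 0 ∧ c = 0 ∧ d = 0 := by
      rcases mul_eq_zero.mp hfac with h | h
      · obtain ⟨ha, hb⟩ := eq_zero_of_sq_eq_mul_sq h₁ (sub_eq_zero.mp h)
        rw [ha, hb] at hp0
        have : c ^ 2 = D₁ * d ^ 2 := by
          apply mul_left_cancel₀ hD₂
          linarith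
        obtain ⟨hc, hd⟩ := eq_zero_of_sq_eq_mul_sq h₁ this
        exact ⟨ha, hb, hc, hd⟩
      · obtain ⟨ha, hd⟩ := eq_zero_of_sq_eq_mul_sq h₁₂ (sub_eq_zero.mp h)
        rw [ha, hd] at hp0
        have : (D₂ * c) ^ 2 = (D₁ * D₂ : ℕ) * b ^ 2 := by
          push_cast
          linear_combination D₂ * hp0
        obtain ⟨hc, hb⟩ := eq_zero_of_sq_eq_mul_sq h₁₂ this
        exact ⟨ha, hb, (mul_eq_zero.mp hc).resolve_left hD₂, hd⟩
    obtain ⟨rfl, rfl, rfl, rfl⟩ := hall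
    apply h0
    funext i
    fin_cases i <;> simp [e0, e1, e2, e3]
  exact_mod_cast Int.one_le_abs hne

set_option maxHeartbeats 1000000 in
/-- The choice of parameters in the lower bound for linear forms in two logarithms. -/
theorem exists_parameters {p g Λ l₁ l₂ z₁ z₂ : ℝ} (hΛ : 1 ≤ Λ) (hg : 10 ^ 11 * Λ ≤ g)
    (hgp : g ^ 12 ≤ p) (hexp : Real.exp Λ = p ^ 4) (hl₁ : 1 / 2 ≤ l₁) (hl₁' : l₁ ≤ p / g ^ 4)
    (hl₂ : 1 / 2 ≤ l₂) (hl₂' : l₂ ≤ p / g ^ 4) (hz₁ : p ^ 4 / 5 ≤ z₁) (hz₁' : z₁ ≤ 2 * p ^ 4)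
    (hz : |z₁ - z₂| ≤ 2 * (p ^ 2 / g ^ 12)) :
    ∃ t₁ t₂ q h₁ h₂ l : ℕ, 0 < t₁ ∧ 0 < h₁ ∧ 0 < h₂ ∧ 400000 ≤ l ∧ t₁ * l₁ + t₂ * l₂ ≤ h₁ ∧
      13 * (p ^ 2 / g ^ 12) + |z₁ - q * (t₁ * l₁)| + |z₂ - q * (t₂ * l₂)| ≤ h₂ ∧
      1000 * l * h₂ ≤ q ∧ q * |t₂ * l₂ - t₁ * l₁| ≤ h₂ ∧
      ((1000 * l * h₂ + l + q * (1000 * l * h₁) : ℕ) : ℝ) ≤ Real.exp (l / 400000) ∧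
      13000 * ((l ^ 2 * h₁ * h₂ : ℕ) : ℝ) ≤ p ^ 4 / 5 := by
  have hg1 : 10 ^ 11 ≤ g := by linarith
  have hg0 : 0 < g := by linarith
  have hp1 : g ≤ p := le_trans (le_self_pow₀ (by linarith) (by norm_num)) hgp
  have hp0 : 0 < p := by linarith
  have hone : 1 ≤ p / g ^ 2 := by
    rw [le_div_iff₀ (by positivity), one_mul]
    exact (pow_le_pow_right₀ (by linarith) (by norm_num)).trans hgp
  set V : ℝ := p ^ 2 / g ^ 12 with hV
  have hV1 : 1 ≤ V := by
    rw [hV, le_div_iff₀ (by positivity), one_mul]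
    exact hgp.trans (le_self_pow₀ (by linarith) (by norm_num))
  have hV6 : V ≤ p ^ 2 / g ^ 6 := by
    rw [hV]; gcongr
    · linarith
    · norm_num
  set T : ℕ := ⌈p / g ^ 2⌉₊ with hT
  have hT1 : p / g ^ 2 ≤ T := Nat.le_ceil _
  have hT2 : (T : ℝ) ≤ 2 * (p / g ^ 2) := by
    have := Nat.ceil_lt_add_one (by positivity : 0 ≤ p / g ^ 2)
    linarith
  have hTpos : 0 < T := by
    have : (0 : ℝ) < T := by linarith
    exact_mod_cast this
  have hl₂0 : 0 < l₂ := by linarith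
  obtain ⟨j, k, hk0, hkT, hjk⟩ := Real.exists_int_int_abs_mul_sub_le (l₁ / l₂) hTpos
  have hclose : |k * l₁ - j * l₂| ≤ 1 / g ^ 2 := by
    have h1 : (k : ℝ) * l₁ - j * l₂ = (k * (l₁ / l₂) - j) * l₂ := by field_simp
    rw [h1, abs_mul, abs_of_pos hl₂0]
    calc |k * (l₁ / l₂) - j| * l₂ ≤ 1 / (T + 1) * (p / g ^ 4) := by gcongr
      _ ≤ 1 / (p / g ^ 2) * (p / g ^ 4) := by gcongr; linarith
      _ = 1 / g ^ 2 := by field_simp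
  have hg2 : 1 / g ^ 2 ≤ 1 / 2 := by
    gcongr
    nlinarith
  have hkR : (1 : ℝ) ≤ k := by exact_mod_cast hk0
  have hj0 : 0 ≤ j := by
    by_contra h
    have h1 : (j : ℝ) ≤ -1 := by exact_mod_cast (by omega : j ≤ -1)
    have := (abs_le.mp hclose).2
    nlinarith
  lift k to ℕ using hk0.le
  lift j to ℕ using hj0
  rw [Int.cast_natCast, Int.cast_natCast] at hclose
  rw [Int.cast_natCast] at hkR
  have hkT' : (k : ℝ) ≤ T := by exact_mod_cast hkT
  set τ : ℝ := k * l₁ with hτ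
  have hτ1 : 1 / 2 ≤ τ := by rw [hτ]; nlinarith
  have hτ2 : τ ≤ 2 * (p ^ 2 / g ^ 6) := by
    calc τ ≤ 2 * (p / g ^ 2) * (p / g ^ 4) := by rw [hτ]; gcongr; linarith
      _ = _ := by field_simp
  have hτ3 : τ ≤ 2 * p ^ 2 := by
    refine hτ2.trans ?_
    gcongr
    exact div_le_self (by positivity) (one_le_pow₀ (by linarith))
  have hτ0 : 0 < τ := by linarith
  have hz₁0 : 0 ≤ z₁ := le_trans (by positivity) hz₁
  set q : ℕ := ⌊z₁ / τ⌋₊ with hq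
  have hq1 : q * τ ≤ z₁ := by
    have := Nat.floor_le (by positivity : 0 ≤ z₁ / τ)
    rwa [le_div_iff₀ hτ0] at this
  have hq2 : z₁ < (q + 1) * τ := by
    have := Nat.lt_floor_add_one (z₁ / τ)
    rwa [div_lt_iff₀ hτ0] at this
  have hq0 : (0 : ℝ) ≤ q := Nat.cast_nonneg _
  have hq4 : (q : ℝ) ≤ 4 * p ^ 4 := by nlinarith
  have hqlow : p ^ 2 / g ^ 5 ≤ q := by
    have h1 : p ^ 4 / 5 < (q + 1) * (2 * (p ^ 2 / g ^ 6)) :=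
      (hz₁.trans_lt hq2).trans_le (by gcongr)
    have h2 : p ^ 2 * g ^ 6 < 10 * (q + 1) := by
      have h3 : (q + 1) * (2 * (p ^ 2 / g ^ 6)) = 2 * p ^ 2 * (q + 1) / g ^ 6 := by ring
      rw [h3, lt_div_iff₀ (by positivity)] at h1
      have h4 : p ^ 2 * (p ^ 2 * g ^ 6) < p ^ 2 * (10 * (q + 1)) := by linarith
      exact lt_of_mul_lt_mul_left h4 (by positivity)
    have h5 : p ^ 2 / g ^ 5 ≤ p ^ 2 := div_le_self (by positivity) (one_le_pow₀ (by linarith))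
    have h6 : 10 ^ 11 ≤ g ^ 6 := hg1.trans (le_self_pow₀ (by linarith) (by norm_num))
    have h7 : p ^ 2 * 10 ^ 11 ≤ p ^ 2 * g ^ 6 := by gcongr
    have h8 : 1 ≤ p ^ 2 := one_le_pow₀ (by linarith)
    linarith
  set h₁ : ℕ := ⌈2 * τ + 1⌉₊ with hh₁
  have hh1 : 2 * τ + 1 ≤ h₁ := Nat.le_ceil _
  have hh1' : (h₁ : ℝ) ≤ 6 * τ := by
    have := Nat.ceil_lt_add_one (by positivity : 0 ≤ 2 * τ + 1)
    linarith
  set ρ : ℝ := |(k : ℝ) * l₁ - j * l₂| with hρ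
  have hρ0 : 0 ≤ ρ := abs_nonneg _
  have hρ' : |(j : ℝ) * l₂ - τ| = ρ := abs_sub_comm _ _
  set h₂ : ℕ := ⌈15 * V + 2 * τ + q * ρ⌉₊ with hh₂
  have hh2 : 15 * V + 2 * τ + q * ρ ≤ h₂ := Nat.le_ceil _
  have hh2' : (h₂ : ℝ) ≤ 20 * (p ^ 2 / g ^ 6) + q / g ^ 2 := by
    have h1 := Nat.ceil_lt_add_one (by positivity : 0 ≤ 15 * V + 2 * τ + q * ρ)
    have h2 : q * ρ ≤ q * (1 / g ^ 2) := by gcongr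
    rw [mul_one_div] at h2
    linarith
  set l : ℕ := ⌈2000000 * Λ⌉₊ with hl
  have hl1 : 2000000 * Λ ≤ l := Nat.le_ceil _
  have hl2 : (l : ℝ) ≤ g / 40000 := by
    have := Nat.ceil_lt_add_one (by positivity : 0 ≤ 2000000 * Λ)
    linarith
  have hl0 : (0 : ℝ) ≤ l := Nat.cast_nonneg _
  have hqh : 1000 * (l : ℝ) * h₂ ≤ q := by
    have h1 : 1000 * (l : ℝ) * h₂ ≤
        1000 * (g / 40000) * (20 * (p ^ 2 / g ^ 6) + q / g ^ 2) := by gcongr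
    have h2 : 1000 * (g / 40000) * (20 * (p ^ 2 / g ^ 6) + q / g ^ 2) =
        1 / 2 * (p ^ 2 / g ^ 5) + q / (40 * g) := by field_simp; ring
    have h3 : q / (40 * g) ≤ q / 2 := by gcongr; linarith
    linarith
  have hbig : (h₂ : ℝ) * h₁ * l ^ 2 ≤ p ^ 4 / 10 ^ 6 := by
    have h1 : (h₂ : ℝ) * h₁ * l ^ 2 ≤
        (20 * (p ^ 2 / g ^ 6) + q / g ^ 2) * (6 * τ) * (g / 40000) ^ 2 := by gcongr
    have h2 : (20 * (p ^ 2 / g ^ 6) + q / g ^ 2) * (6 * τ) * (g / 40000) ^ 2 =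
        6 / 40000 ^ 2 * (20 * (p ^ 2 / g ^ 4) * τ + q * τ) := by field_simp
    have h3 : p ^ 2 / g ^ 4 ≤ p ^ 2 := div_le_self (by positivity) (one_le_pow₀ (by linarith))
    have h4 : 20 * (p ^ 2 / g ^ 4) * τ ≤ 20 * p ^ 2 * (2 * p ^ 2) := by gcongr
    have h5 : q * τ ≤ 2 * p ^ 4 := hq1.trans hz₁'
    nlinarith
  refine ⟨k, j, q, h₁, h₂, l, by exact_mod_cast hk0, ?_, ?_, ?_, ?_, ?_, ?_, ?_, ?_, ?_⟩
  · have : (0 : ℝ) < h₁ := by linarith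
    exact_mod_cast this
  · have : (0 : ℝ) < h₂ := by have := mul_nonneg hq0 hρ0; linarith
    exact_mod_cast this
  · have : (400000 : ℝ) ≤ l := by linarith
    exact_mod_cast this
  · have := (abs_le.mp hclose).1
    linarith
  · have h1 : |z₁ - q * τ| ≤ τ := by rw [abs_le]; constructor <;> linarith
    have h2 : |z₂ - q * (j * l₂)| ≤ 2 * V + τ + q * ρ := by
      have e : z₂ - q * (j * l₂) = (z₂ - z₁) + (z₁ - q * τ) + q * (k * l₁ - j * l₂) := by
        rw [hτ]; ring
      rw [e]
      refine (abs_add_three _ _ _).trans ?_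
      rw [abs_mul, abs_of_nonneg hq0, abs_sub_comm z₂ z₁]
      linarith
    linarith
  · exact_mod_cast hqh
  · rw [hρ']; linarith
  · have h1 : p ^ 20 ≤ Real.exp (l / 400000) := by
      calc p ^ 20 = Real.exp (5 * Λ) := by
            rw [show (5 : ℝ) * Λ = (5 : ℕ) * Λ by norm_num, Real.exp_nat_mul, hexp]; ring
        _ ≤ _ := Real.exp_le_exp.mpr (by linarith)
    refine le_trans ?_ h1
    push_cast
    have h2 : q * (1000 * l * h₁) ≤ 4 * p ^ 4 * (1000 * (p / 40000) * (6 * (2 * p ^ 2))) := by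
      gcongr
      · linarith
      · linarith
    have h3 : (l : ℝ) ≤ p := by linarith
    have h4 : p ≤ p ^ 7 := le_self_pow₀ (by linarith) (by norm_num)
    have h5 : p ^ 4 ≤ p ^ 7 := pow_le_pow_right₀ (by linarith) (by norm_num)
    have h6 : p ^ 7 * p ≤ p ^ 20 := by
      rw [← pow_succ]; exact pow_le_pow_right₀ (by linarith) (by norm_num)
    have h7 : p ^ 7 * 10 ^ 11 ≤ p ^ 7 * p := by gcongr; linarith
    have h8 : 4 * p ^ 4 * (1000 * (p / 40000) * (6 * (2 * p ^ 2))) = 6 / 5 * p ^ 7 := by ring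
    have h9 : 0 < p ^ 7 := by positivity
    linarith
  · push_cast
    have : 0 < p ^ 4 := by positivity
    nlinarith

theorem sq_conj_eq_exp {D : ℕ} (hD : ¬ IsSquare D) {X Y : ℤ} (hZ : 0 < (X : ℝ) + Y * √(D : ℝ)) :
    ((X : ℝ) + Y * √(D : ℝ)) ^ 2 = Real.exp (2 * Real.log (X + Y * √(D : ℝ))) ∧
    ((X : ℝ) - Y * √(D : ℝ)) ^ 2 = Real.exp (2 * Real.log |((X ^ 2 - D * Y ^ 2 : ℤ) : ℝ)| -
      2 * Real.log (X + Y * √(D : ℝ))) ∧ (1 : ℝ) ≤ |((X ^ 2 - D * Y ^ 2 : ℤ) : ℝ)| := by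
  have hss : √(D : ℝ) ^ 2 = D := Real.sq_sqrt (Nat.cast_nonneg _)
  have hN : X ^ 2 - D * Y ^ 2 ≠ 0 := by
    intro h
    obtain ⟨rfl, rfl⟩ := eq_zero_of_sq_eq_mul_sq hD (sub_eq_zero.mp h)
    simp at hZ
  have hNR : ((X ^ 2 - D * Y ^ 2 : ℤ) : ℝ) ≠ 0 := by exact_mod_cast hN
  have hexp : ∀ x : ℝ, 0 < x → Real.exp (2 * Real.log x) = x ^ 2 := fun x hx => by
    rw [two_mul, Real.exp_add, Real.exp_log hx]; ring
  refine ⟨(hexp _ hZ).symm, ?_, by exact_mod_cast Int.one_le_abs hN⟩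
  rw [Real.exp_sub, hexp _ hZ, hexp _ (abs_pos.mpr hNR), sq_abs]
  have : ((X ^ 2 - D * Y ^ 2 : ℤ) : ℝ) = (X + Y * √(D : ℝ)) * (X - Y * √(D : ℝ)) := by
    push_cast; linear_combination (Y : ℝ) ^ 2 * hss
  rw [this]
  field_simp

theorem pell_log_conj {D u v : ℕ} (h : u ^ 2 = D * v ^ 2 + 1) (hu : 0 < u) :
    (u : ℝ) + v * √(D : ℝ) = Real.exp (Real.log (u + v * √(D : ℝ))) ∧
    (u : ℝ) - v * √(D : ℝ) = Real.exp (-Real.log (u + v * √(D : ℝ))) := by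
  have hss : √(D : ℝ) ^ 2 = D := Real.sq_sqrt (Nat.cast_nonneg _)
  have hpos : 0 < (u : ℝ) + v * √(D : ℝ) := by
    have : (0 : ℝ) < u := by exact_mod_cast hu
    positivity
  rw [Real.exp_neg, Real.exp_log hpos]
  refine ⟨rfl, eq_inv_of_mul_eq_one_left ?_⟩
  have h1 : (u : ℝ) ^ 2 = D * v ^ 2 + 1 := by exact_mod_cast h
  linear_combination h1 - (v : ℝ) ^ 2 * hss

/-- Two nearly equal elements of distinct real quadratic fields, compared through units. -/
theorem not_small_of_units {D₁ D₂ : ℕ} (hD₁ : ¬ IsSquare D₁) (hD₂ : ¬ IsSquare D₂)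
    (hD : ¬ IsSquare (D₁ * D₂)) {u₁ v₁ u₂ v₂ : ℕ} (hu₁ : 0 < u₁) (hu₂ : 0 < u₂)
    (hp₁ : u₁ ^ 2 = D₁ * v₁ ^ 2 + 1) (hp₂ : u₂ ^ 2 = D₂ * v₂ ^ 2 + 1) {X₁ Y₁ X₂ Y₂ : ℤ}
    (hZ₁ : 0 < (X₁ : ℝ) + Y₁ * √(D₁ : ℝ)) (hZ₂ : 0 < (X₂ : ℝ) + Y₂ * √(D₂ : ℝ))
    {l₁ l₂ z₁ z₂ : ℝ} (hl₁ : l₁ = Real.log (u₁ + v₁ * √(D₁ : ℝ)))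
    (hl₂ : l₂ = Real.log (u₂ + v₂ * √(D₂ : ℝ))) (hl₁0 : 0 < l₁)
    (hz₁ : z₁ = 2 * Real.log (X₁ + Y₁ * √(D₁ : ℝ))) (hz₂ : z₂ = 2 * Real.log (X₂ + Y₂ * √(D₂ : ℝ)))
    {b c : ℕ} (hb : 0 < b) (hc : 0 < c) {H E : ℝ}
    (hH : Real.log c + Real.log b + 2 * Real.log |((X₁ ^ 2 - D₁ * Y₁ ^ 2 : ℤ) : ℝ)| +
      2 * Real.log |((X₂ ^ 2 - D₂ * Y₂ ^ 2 : ℤ) : ℝ)| ≤ H)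
    (hE : c * ((X₁ : ℝ) + Y₁ * √(D₁ : ℝ)) ^ 2 =
      b * ((X₂ : ℝ) + Y₂ * √(D₂ : ℝ)) ^ 2 * Real.exp E)
    {t₁ t₂ q h₁ h₂ l : ℕ} (ht₁ : 0 < t₁) (hh₁ : 0 < h₁) (hh₂ : 0 < h₂) (hl : 400000 ≤ l)
    (ht : t₁ * l₁ + t₂ * l₂ ≤ h₁)
    (hz : H + |z₁ - q * (t₁ * l₁)| + |z₂ - q * (t₂ * l₂)| ≤ h₂) (hq : 1000 * l * h₂ ≤ q)
    (hω : q * |t₂ * l₂ - t₁ * l₁| ≤ h₂)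
    (hX : ((1000 * l * h₂ + l + q * (1000 * l * h₁) : ℕ) : ℝ) ≤ Real.exp (l / 400000))
    (hEsmall : |E| ≤ Real.exp (-(13000 * ((l ^ 2 * h₁ * h₂ : ℕ) : ℝ)))) : False := by
  obtain ⟨hZ₁e, hZ₁c, hN₁⟩ := sq_conj_eq_exp hD₁ hZ₁
  obtain ⟨hZ₂e, hZ₂c, hN₂⟩ := sq_conj_eq_exp hD₂ hZ₂
  obtain ⟨he₁, he₁c⟩ := pell_log_conj hp₁ hu₁
  obtain ⟨he₂, he₂c⟩ := pell_log_conj hp₂ hu₂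
  rw [← hl₁] at he₁ he₁c
  rw [← hl₂] at he₂ he₂c
  rw [← hz₁] at hZ₁e hZ₁c
  rw [← hz₂] at hZ₂e hZ₂c
  have hν₁ := Real.log_nonneg hN₁
  have hν₂ := Real.log_nonneg hN₂
  set ν₁ := Real.log |((X₁ ^ 2 - D₁ * Y₁ ^ 2 : ℤ) : ℝ)|
  set ν₂ := Real.log |((X₂ ^ 2 - D₂ * Y₂ ^ 2 : ℤ) : ℝ)| with hν₂def
  have hl₂0 : 0 ≤ l₂ := by
    rw [hl₂]
    apply Real.log_nonneg
    have : (1 : ℝ) ≤ u₂ := by exact_mod_cast hu₂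
    have : 0 ≤ v₂ * √(D₂ : ℝ) := by positivity
    linarith
  have hbR : (0 : ℝ) < b := by exact_mod_cast hb
  have hcR : (0 : ℝ) < c := by exact_mod_cast hc
  have hlogb : 0 ≤ Real.log b := Real.log_natCast_nonneg _
  have hlogc : 0 ≤ Real.log c := Real.log_natCast_nonneg _
  set s₁ := √(D₁ : ℝ)
  set s₂ := √(D₂ : ℝ)
  set e₁ : Fin 4 → ℝ := ![u₁ - v₁ * s₁, u₁ + v₁ * s₁, u₁ - v₁ * s₁, u₁ + v₁ * s₁] with he₁def
  set e₂ : Fin 4 → ℝ := ![u₂ + v₂ * s₂, u₂ + v₂ * s₂, u₂ - v₂ * s₂, u₂ - v₂ * s₂] with he₂def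
  set ζ₁ : Fin 4 → ℝ := ![X₁ + Y₁ * s₁, X₁ - Y₁ * s₁, X₁ + Y₁ * s₁, X₁ - Y₁ * s₁] with hζ₁def
  set ζ₂ : Fin 4 → ℝ := ![X₂ - Y₂ * s₂, X₂ - Y₂ * s₂, X₂ + Y₂ * s₂, X₂ + Y₂ * s₂] with hζ₂def
  have he₁I : e₁ ∈ biquadraticRing D₁ D₂ := ⟨u₁, -v₁, 0, 0, by simp [he₁def, sub_eq_add_neg, s₁]⟩
  have he₂I : e₂ ∈ biquadraticRing D₁ D₂ := ⟨u₂, 0, v₂, 0, by simp [he₂def, s₂]⟩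
  have hζ₁I : ζ₁ ∈ biquadraticRing D₁ D₂ := ⟨X₁, Y₁, 0, 0, by simp [hζ₁def, s₁]⟩
  have hζ₂I : ζ₂ ∈ biquadraticRing D₁ D₂ :=
    ⟨X₂, 0, -Y₂, 0, by simp [hζ₂def, sub_eq_add_neg, s₂]⟩
  set β : Fin 4 → ℝ := e₁ ^ t₁ * e₂ ^ t₂ with hβ
  set η : Fin 4 → ℝ := c * ζ₁ ^ 2 * ζ₂ ^ 2 * β ^ q with hη
  have hβI : β ∈ biquadraticRing D₁ D₂ := mul_mem (pow_mem he₁I _) (pow_mem he₂I _)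
  have hηI : η ∈ biquadraticRing D₁ D₂ := mul_mem (mul_mem (mul_mem (natCast_mem _ _)
    (pow_mem hζ₁I _)) (pow_mem hζ₂I _)) (pow_mem hβI _)
  have hβ0 : β 0 = Real.exp (t₂ * l₂ - t₁ * l₁) := by
    simp only [hβ, Pi.mul_apply, Pi.pow_apply, he₁def, he₂def, Matrix.cons_val_zero]
    rw [he₁c, he₂, ← Real.exp_nat_mul, ← Real.exp_nat_mul, ← Real.exp_add]
    ring_nf
  have hβ1 : β 1 = Real.exp (t₂ * l₂ + t₁ * l₁) := by
    simp only [hβ, Pi.mul_apply, Pi.pow_apply, he₁def, he₂def, Matrix.cons_val_one,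
      Matrix.cons_val_zero]
    rw [he₁, he₂, ← Real.exp_nat_mul, ← Real.exp_nat_mul, ← Real.exp_add]
    ring_nf
  have hβ2 : β 2 = Real.exp (-(t₂ * l₂) - t₁ * l₁) := by
    simp only [hβ, Pi.mul_apply, Pi.pow_apply, he₁def, he₂def, Matrix.cons_val]
    rw [he₁c, he₂c, ← Real.exp_nat_mul, ← Real.exp_nat_mul, ← Real.exp_add]
    ring_nf
  have hβ3 : β 3 = Real.exp (-(t₂ * l₂) + t₁ * l₁) := by
    simp only [hβ, Pi.mul_apply, Pi.pow_apply, he₁def, he₂def, Matrix.cons_val]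
    rw [he₁, he₂c, ← Real.exp_nat_mul, ← Real.exp_nat_mul, ← Real.exp_add]
    ring_nf
  have hη' : ∀ i, ∀ x y w : ℝ, ζ₁ i ^ 2 = Real.exp x → ζ₂ i ^ 2 = Real.exp y →
      β i = Real.exp w → η i = Real.exp (Real.log c + x + y + q * w) := by
    intro i x y w hx hy hw
    simp only [hη, Pi.mul_apply, Pi.pow_apply, Pi.natCast_apply, hx, hy, hw]
    rw [Real.exp_add, Real.exp_add, Real.exp_add, Real.exp_log hcR, Real.exp_nat_mul]
  have hη0 := hη' 0 _ _ _ hZ₁e hZ₂c hβ0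
  have hη1 := hη' 1 _ _ _ hZ₁c hZ₂c hβ1
  have hη2 := hη' 2 _ _ _ hZ₁e hZ₂e hβ2
  have hη3 := hη' 3 _ _ _ hZ₁c hZ₂e hβ3
  have hd : ((b * ((X₂ ^ 2 - D₂ * Y₂ ^ 2).natAbs) ^ 2 : ℕ) : ℝ) =
      Real.exp (Real.log b + 2 * ν₂) := by
    rw [Real.exp_add, Real.exp_log hbR, two_mul, Real.exp_add, hν₂def,
      Real.exp_log (by linarith)]
    push_cast [Nat.cast_natAbs]
    ring
  have hA₁ := abs_le.mp (le_refl |z₁ - q * (t₁ * l₁)|)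
  have hA₂ := abs_le.mp (le_refl |z₂ - q * (t₂ * l₂)|)
  have htl₁ : 0 < t₁ * l₁ := by positivity
  have htl₂ : 0 ≤ t₂ * l₂ := by positivity
  have hfour : ∀ P : Fin 4 → Prop, P 0 → P 1 → P 2 → P 3 → ∀ i, P i := by
    intro P h0 h1 h2 h3 i
    fin_cases i <;> assumption
  refine not_small_linear_form_two_logs (biquadraticRing D₁ D₂)
    (fun v hv hv0 => one_le_prod_abs_of_mem_biquadraticRing hD₁ hD₂ hD hv
      (fun h => hv0 (congrFun h 0))) hβI hηI
    (d := b * ((X₂ ^ 2 - D₂ * Y₂ ^ 2).natAbs) ^ 2) ?_ hh₁ hh₂ hl ?_ ?_ ?_ ?_ ?_ ?_ hq ?_ hX ?_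
    hEsmall
  · have : (0 : ℝ) < ((b * ((X₂ ^ 2 - D₂ * Y₂ ^ 2).natAbs) ^ 2 : ℕ) : ℝ) := by
      rw [hd]; exact Real.exp_pos _
    exact_mod_cast this
  · rw [hβ0]; exact Real.exp_pos _
  · intro h
    by_cases hne : β - 1 = 0
    · have h1 := congrFun hne 1
      rw [Pi.sub_apply, hβ1, Pi.one_apply, Pi.zero_apply, sub_eq_zero, Real.exp_eq_one_iff] at h1
      linarith
    · have h1 := one_le_prod_abs_of_mem_biquadraticRing hD₁ hD₂ hD
        (sub_mem hβI (one_mem _)) hne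
      rw [Finset.prod_eq_zero (Finset.mem_univ 0) (by simp [h])] at h1
      norm_num at h1
  · rw [hη0]; exact Real.exp_pos _
  · refine hfour _ ?_ ?_ ?_ ?_
    · simp only [hβ0, Real.abs_exp, Real.exp_le_exp]; linarith
    · simp only [hβ1, Real.abs_exp, Real.exp_le_exp]; linarith
    · simp only [hβ2, Real.abs_exp, Real.exp_le_exp]; linarith
    · simp only [hβ3, Real.abs_exp, Real.exp_le_exp]; linarith
  · refine hfour _ ?_ ?_ ?_ ?_
    · simp only [hη0, Real.abs_exp, Real.exp_le_exp]; linarith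
    · simp only [hη1, Real.abs_exp, Real.exp_le_exp]; linarith
    · simp only [hη2, Real.abs_exp, Real.exp_le_exp]; linarith
    · simp only [hη3, Real.abs_exp, Real.exp_le_exp]; linarith
  · rw [hd, Real.exp_le_exp]
    have := abs_nonneg (z₁ - q * (t₁ * l₁))
    have := abs_nonneg (z₂ - q * (t₂ * l₂))
    linarith
  · rw [hβ0, Real.log_exp]; exact hω
  · rw [hd, hη0, hβ0, ← Real.exp_nat_mul, ← Real.exp_sub, ← Real.exp_add]
    rw [hZ₁e, hZ₂e] at hE
    have h1 : Real.exp (Real.log c + z₁) = Real.exp (Real.log b + z₂ + E) := by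
      rw [Real.exp_add, Real.exp_add, Real.exp_add, Real.exp_log hcR, Real.exp_log hbR, hE]
    have h2 := Real.exp_injective h1
    congr 1
    linarith

theorem abs_log_one_add_le {θ : ℝ} (hθ : |θ| ≤ 1 / 2) : |Real.log (1 + θ)| ≤ 2 * |θ| := by
  obtain ⟨h1, h2⟩ := abs_le.mp hθ
  have hpos : 0 < 1 + θ := by linarith
  have hup := Real.log_le_sub_one_of_pos hpos
  have hlow := Real.one_sub_inv_le_log_of_pos hpos
  have h3 : 1 - (1 + θ)⁻¹ = θ / (1 + θ) := by field_simp; ring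
  rw [h3] at hlow
  rw [abs_le]
  constructor
  · refine le_trans ?_ hlow
    rw [le_div_iff₀ hpos]
    cases abs_cases θ <;> nlinarith
  · cases abs_cases θ <;> linarith

/-- An element `X + Y √D` of small norm is close to `2 Y √D`. -/
theorem exists_log_eq_of_small_norm {D : ℕ} (hD0 : 0 < D) {X Y : ℕ} (hY : 0 < Y) {M : ℝ}
    (hN : |(((X : ℤ) ^ 2 - D * (Y : ℤ) ^ 2 : ℤ) : ℝ)| ≤ M) (hM : M ≤ (Y : ℝ) ^ 2) :
    ∃ e : ℝ, |e| ≤ M / (Y : ℝ) ^ 2 ∧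
      (X : ℝ) + Y * √(D : ℝ) = 2 * Y * √(D : ℝ) * Real.exp e := by
  have hss : √(D : ℝ) ^ 2 = D := Real.sq_sqrt (Nat.cast_nonneg _)
  have hDR : (1 : ℝ) ≤ D := by exact_mod_cast hD0
  have hs1 : 1 ≤ √(D : ℝ) := Real.one_le_sqrt.mpr hDR
  have hYR : (0 : ℝ) < Y := by exact_mod_cast hY
  push_cast at hN
  generalize √(D : ℝ) = s at hss hs1 ⊢
  have hXR : (0 : ℝ) ≤ X := Nat.cast_nonneg _
  rw [← hss] at hN hDR
  set θ : ℝ := (X - Y * s) / (2 * Y * s) with hθ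
  have hθb : |θ| ≤ M / (Y : ℝ) ^ 2 / 2 := by
    rw [hθ, abs_div, abs_of_pos (by positivity : 0 < 2 * Y * s), div_le_iff₀ (by positivity)]
    have h1 : |(X : ℝ) - Y * s| * (X + Y * s) ≤ M := by
      have e : |(X : ℝ) - Y * s| * (X + Y * s) = |(X : ℝ) ^ 2 - s ^ 2 * Y ^ 2| := by
        rw [show (X : ℝ) ^ 2 - s ^ 2 * Y ^ 2 = (X - Y * s) * (X + Y * s) by ring, abs_mul,
          abs_of_pos (by positivity : 0 < (X : ℝ) + Y * s)]
      rw [e]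
      exact hN
    have h2 : |(X : ℝ) - Y * s| * (Y * s) ≤ M := le_trans (by gcongr; linarith) h1
    have h3 : |(X : ℝ) - Y * s| * Y ≤ M :=
      le_trans (by gcongr; exact le_mul_of_one_le_right hYR.le hs1) h2
    have h4 : M / (Y : ℝ) ^ 2 / 2 * (2 * Y * s) = M / Y * s := by field_simp
    rw [h4]
    have h5 : |(X : ℝ) - Y * s| ≤ M / Y := by rwa [le_div_iff₀ hYR]
    have h6 : 0 ≤ M / Y := (abs_nonneg _).trans h5
    exact h5.trans (le_mul_of_one_le_right h6 hs1)
  have hM1 : M / (Y : ℝ) ^ 2 ≤ 1 := by rw [div_le_one (by positivity)]; exact hM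
  have hθ2 : |θ| ≤ 1 / 2 := by linarith
  refine ⟨Real.log (1 + θ), (abs_log_one_add_le hθ2).trans (by linarith), ?_⟩
  rw [Real.exp_log (by linarith [(abs_le.mp hθ2).1]), hθ]
  field_simp
  ring

theorem half_le_log_pell {D u v : ℕ} (hD : 1 ≤ D) (hu : 0 < u) (hv : 0 < v) :
    1 / 2 ≤ Real.log (u + v * √(D : ℝ)) := by
  have h1 : 1 ≤ √(D : ℝ) := Real.one_le_sqrt.mpr (by exact_mod_cast hD)
  have h2 : (1 : ℝ) ≤ u := by exact_mod_cast hu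
  have h3 : (1 : ℝ) ≤ v := by exact_mod_cast hv
  have h4 : (2 : ℝ) ≤ u + v * √(D : ℝ) := by nlinarith
  have := Real.log_le_log (by norm_num) h4
  have := Real.log_two_gt_d9
  linarith

/-- Three pairwise inequivalent offsets `a`, `b`, `c` with simultaneously small norms would give a
linear form in two logarithms of Pell units that is too small. -/
theorem false_of_three_small_norms {p g Λ V : ℝ} (hΛ : 1 ≤ Λ) (hg : 10 ^ 11 * Λ ≤ g)
    (hgp : g ^ 12 ≤ p) (hexp : Real.exp Λ = p ^ 4) (hV : V = p ^ 2 / g ^ 12)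
    (hpell : ∀ D : ℕ, ¬ IsSquare D → (D : ℝ) ≤ 5329 * V → ∃ x y : ℕ, 0 < x ∧ 0 < y ∧
      x ^ 2 = D * y ^ 2 + 1 ∧ Real.log (x + y * √(D : ℝ)) ≤ p / g ^ 4)
    {a b c x y w : ℕ} (ha : 0 < a) (hb : 0 < b) (hc : 0 < c) (hx : 0 < x)
    (hab : ¬ IsSquare (a * b)) (hac : ¬ IsSquare (a * c)) (hbc : ¬ IsSquare (b * c))
    (habV : ((a * b : ℕ) : ℝ) ≤ 5329 * V) (hacV : ((a * c : ℕ) : ℝ) ≤ 5329 * V)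
    (hbV : Real.log b ≤ V / 2) (hcV : Real.log c ≤ V / 2)
    (hN₁ : |((((a * y : ℕ) : ℤ) ^ 2 - (a * b : ℕ) * (x : ℤ) ^ 2 : ℤ) : ℝ)| ≤ Real.exp (3 * V))
    (hN₂ : |((((a * w : ℕ) : ℤ) ^ 2 - (a * c : ℕ) * (x : ℤ) ^ 2 : ℤ) : ℝ)| ≤ Real.exp (3 * V))
    (hxlow : Real.exp (p ^ 4 / 4) ≤ (x : ℝ) ^ 2) (hxup : (x : ℝ) ^ 2 ≤ Real.exp (p ^ 4)) :
    False := by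
  have hg1 : 10 ^ 11 ≤ g := by linarith
  have hg0 : 0 < g := by linarith
  have hp1 : 10 ^ 11 ≤ p := hg1.trans ((le_self_pow₀ (by linarith) (by norm_num)).trans hgp)
  have hp0 : 0 < p := by linarith
  have hVp : p ≤ V := by
    rw [hV, le_div_iff₀ (by positivity), sq]
    gcongr
  have hVp2 : V ≤ p ^ 2 := by
    rw [hV]; exact div_le_self (by positivity) (one_le_pow₀ (by linarith))
  have hp24 : p ^ 2 * 10 ^ 22 ≤ p ^ 4 := by
    have : p ^ 4 = p ^ 2 * p ^ 2 := by ring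
    rw [this]; gcongr
    calc (10 : ℝ) ^ 22 = (10 ^ 11) ^ 2 := by norm_num
      _ ≤ p ^ 2 := by gcongr
  have hxR : (0 : ℝ) < x := by exact_mod_cast hx
  have habR : (1 : ℝ) ≤ ((a * b : ℕ) : ℝ) := by exact_mod_cast Nat.mul_pos ha hb
  have hMx : Real.exp (3 * V) ≤ (x : ℝ) ^ 2 :=
    (Real.exp_le_exp.mpr (by linarith)).trans hxlow
  obtain ⟨e₁, he₁, hZ₁⟩ := exists_log_eq_of_small_norm (Nat.mul_pos ha hb) hx hN₁ hMx
  obtain ⟨e₂, he₂, hZ₂⟩ := exists_log_eq_of_small_norm (Nat.mul_pos ha hc) hx hN₂ hMx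
  have hsmall : Real.exp (3 * V) / (x : ℝ) ^ 2 ≤ Real.exp (-(p ^ 4 / 5)) / 4 := by
    rw [div_le_iff₀ (by positivity)]
    have h4 : (4 : ℝ) ≤ Real.exp (2 : ℕ) := le_exp_of_le_two_pow 2 (by norm_num)
    calc Real.exp (3 * V) ≤ Real.exp (-(p ^ 4 / 5) + -(2 : ℕ) + p ^ 4 / 4) :=
          Real.exp_le_exp.mpr (by push_cast; linarith)
      _ = Real.exp (-(p ^ 4 / 5)) / Real.exp (2 : ℕ) * Real.exp (p ^ 4 / 4) := by
          rw [Real.exp_add, Real.exp_add, Real.exp_neg ((2 : ℕ) : ℝ)]; rfl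
      _ ≤ _ := by gcongr
  have hsmall1 : Real.exp (-(p ^ 4 / 5)) ≤ 1 := Real.exp_le_one_iff.mpr (by
    have : 0 < p ^ 4 := by positivity
    linarith)
  set E : ℝ := 2 * (e₁ - e₂) with hE
  have hEb : |E| ≤ Real.exp (-(p ^ 4 / 5)) := by
    rw [hE, abs_mul, abs_two]
    have := abs_sub e₁ e₂
    linarith
  obtain ⟨u₁, v₁, hu₁, hv₁, hp₁, hl₁⟩ := hpell _ hab habV
  obtain ⟨u₂, v₂, hu₂, hv₂, hp₂, hl₂⟩ := hpell _ hac hacV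
  have hsab : 0 < √((a * b : ℕ) : ℝ) := Real.sqrt_pos.mpr (by linarith)
  have hsac : 0 < √((a * c : ℕ) : ℝ) := Real.sqrt_pos.mpr (by exact_mod_cast Nat.mul_pos ha hc)
  have hssab : √((a * b : ℕ) : ℝ) ^ 2 = a * b := by
    rw [Real.sq_sqrt (Nat.cast_nonneg _)]; push_cast; ring
  have hssac : √((a * c : ℕ) : ℝ) ^ 2 = a * c := by
    rw [Real.sq_sqrt (Nat.cast_nonneg _)]; push_cast; ring
  have hZ₁pos : 0 < ((a * y : ℕ) : ℝ) + x * √((a * b : ℕ) : ℝ) := by positivity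
  have hZ₂pos : 0 < ((a * w : ℕ) : ℝ) + x * √((a * c : ℕ) : ℝ) := by positivity
  have hEeq : c * (((a * y : ℕ) : ℝ) + x * √((a * b : ℕ) : ℝ)) ^ 2 =
      b * (((a * w : ℕ) : ℝ) + x * √((a * c : ℕ) : ℝ)) ^ 2 * Real.exp E := by
    have hEe : Real.exp E = Real.exp e₁ ^ 2 / Real.exp e₂ ^ 2 := by
      rw [← Real.exp_nat_mul, ← Real.exp_nat_mul, ← Real.exp_sub, hE]
      push_cast; ring_nf
    rw [hZ₁, hZ₂, hEe]
    simp only [mul_pow, hssab, hssac]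
    field_simp
  set z₁ := 2 * Real.log (((a * y : ℕ) : ℝ) + x * √((a * b : ℕ) : ℝ)) with hz₁
  set z₂ := 2 * Real.log (((a * w : ℕ) : ℝ) + x * √((a * c : ℕ) : ℝ)) with hz₂
  have hbR : (0 : ℝ) < b := by exact_mod_cast hb
  have hcR : (0 : ℝ) < c := by exact_mod_cast hc
  have hlogb : 0 ≤ Real.log b := Real.log_natCast_nonneg _
  have hlogc : 0 ≤ Real.log c := Real.log_natCast_nonneg _
  have hzz : Real.log c + z₁ = Real.log b + z₂ + E := by
    have := congrArg Real.log hEeq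
    rw [Real.log_mul (by positivity) (by positivity), Real.log_mul (by positivity) (by positivity),
      Real.log_mul (by positivity) (by positivity), Real.log_pow, Real.log_pow,
        Real.log_exp] at this
    push_cast at this
    rw [hz₁, hz₂]
    push_cast
    exact this
  have hlog2 := Real.log_two_lt_d9
  have hlog2' := Real.log_two_gt_d9
  have hz₁eq : z₁ = 2 * Real.log 2 + Real.log ((x : ℝ) ^ 2) + Real.log ((a * b : ℕ) : ℝ) +
      2 * e₁ := by
    rw [hz₁, hZ₁, Real.log_mul (by positivity) (Real.exp_ne_zero _), Real.log_exp,
      Real.log_mul (by positivity) (by positivity), Real.log_mul (by norm_num) (by positivity),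
      Real.log_sqrt (Nat.cast_nonneg _), Real.log_pow]
    push_cast
    ring
  have hx1 : p ^ 4 / 4 ≤ Real.log ((x : ℝ) ^ 2) := by
    rw [Real.le_log_iff_exp_le (by positivity)]; exact hxlow
  have hx2 : Real.log ((x : ℝ) ^ 2) ≤ p ^ 4 := by
    rw [Real.log_le_iff_le_exp (by positivity)]; exact hxup
  have hab0 : 0 ≤ Real.log ((a * b : ℕ) : ℝ) := Real.log_natCast_nonneg _
  have hab1 : Real.log ((a * b : ℕ) : ℝ) ≤ 5329 * V :=
    (Real.log_le_self (by linarith)).trans habV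
  have he1 := abs_le.mp he₁
  have hp4 : 0 < p ^ 4 := by positivity
  obtain ⟨t₁, t₂, q, h₁, h₂, l, ht₁, hh₁, hh₂, hl, ht, hz, hq, hω, hX, hfin⟩ :=
    exists_parameters (l₁ := Real.log (u₁ + v₁ * √((a * b : ℕ) : ℝ)))
      (l₂ := Real.log (u₂ + v₂ * √((a * c : ℕ) : ℝ))) (z₁ := z₁) (z₂ := z₂) hΛ hg hgp hexp
      (half_le_log_pell (Nat.mul_pos ha hb) hu₁ hv₁) hl₁
      (half_le_log_pell (Nat.mul_pos ha hc) hu₂ hv₂) hl₂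
      (by rw [hz₁eq]; linarith) (by rw [hz₁eq]; linarith)
      (by
        rw [← hV]
        have h1 : z₁ - z₂ = Real.log b - Real.log c + E := by linarith
        have := abs_le.mp hEb
        rw [h1, abs_le]
        constructor <;> linarith)
  rw [← hV] at hz
  have hD : ¬ IsSquare (a * b * (a * c)) := by
    rintro ⟨k, hk⟩
    apply hbc
    have h1 : a ^ 2 ∣ k ^ 2 := ⟨b * c, by rw [sq k, ← hk]; ring⟩
    obtain ⟨m, rfl⟩ := (Nat.pow_dvd_pow_iff two_ne_zero).mp h1
    refine ⟨m, Nat.eq_of_mul_eq_mul_left (Nat.pow_pos ha : 0 < a ^ 2) ?_⟩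
    linarith
  have hlogN : ∀ n : ℤ, |(n : ℝ)| ≤ Real.exp (3 * V) → Real.log |(n : ℝ)| ≤ 3 * V := by
    intro n hn
    rcases eq_or_ne n 0 with rfl | h
    · simp only [Int.cast_zero, abs_zero, Real.log_zero]; linarith
    · rwa [Real.log_le_iff_le_exp (abs_pos.mpr (by exact_mod_cast h))]
  refine not_small_of_units hab hac hD hu₁ hu₂ hp₁ hp₂ (X₁ := (a * y : ℕ)) (Y₁ := x)
    (X₂ := (a * w : ℕ)) (Y₂ := x) (z₁ := z₁) (z₂ := z₂) (H := 13 * V) (E := E) (b := b) (c := c)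
    ?_ ?_ rfl rfl ?_ ?_ ?_ hb hc ?_ ?_ ht₁ hh₁ hh₂ hl ht hz hq hω hX ?_
  · simpa only [Int.cast_natCast] using hZ₁pos
  · simpa only [Int.cast_natCast] using hZ₂pos
  · have := half_le_log_pell (Nat.mul_pos ha hb) hu₁ hv₁; linarith
  · simp only [Int.cast_natCast]; exact hz₁
  · simp only [Int.cast_natCast]; exact hz₂
  · have := hlogN _ hN₁
    have := hlogN _ hN₂
    linarith
  · simpa only [Int.cast_natCast] using hEeq
  · exact hEb.trans (Real.exp_le_exp.mpr (by linarith))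

/-- Two representations with offsets `a ≠ b` in the same square class force `r = -ab`. -/
theorem eq_neg_mul_of_isSquare_mul {a b u v : ℕ} {R r : ℤ} (ha : 0 < a) (hb : 0 < b)
    (hab : a ≠ b) (hsq : IsSquare (a * b)) (hu : (u : ℤ) ^ 2 = 2 * a * R - a ^ 2 + r)
    (hv : (v : ℤ) ^ 2 = 2 * b * R - b ^ 2 + r)
    (hR : (a * (r - b ^ 2) - b * (r - a ^ 2)) ^ 2 + |(a * (r - b ^ 2) + b * (r - a ^ 2) : ℤ)|
      < 4 * R) : r = -(a * b) := by
  obtain ⟨s, hs⟩ := hsq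
  have hsZ : (a : ℤ) * b = s * s := by exact_mod_cast hs
  set d : ℤ := a * (r - b ^ 2) - b * (r - a ^ 2) with hd
  set e : ℤ := a * (r - b ^ 2) + b * (r - a ^ 2) with he
  set U : ℤ := 4 * (a * b) * R + e with hU
  set W : ℤ := 2 * s * (u * v) with hW
  have hrel : U ^ 2 - W ^ 2 = d ^ 2 := by
    have h1 : W ^ 2 = 4 * (a * b) * ((u : ℤ) ^ 2 * (v : ℤ) ^ 2) := by rw [hW, hsZ]; ring
    rw [h1, hu, hv, hU, hd, he]
    ring
  have hW0 : 0 ≤ W := by positivity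
  have hd0 : 0 ≤ d ^ 2 := sq_nonneg d
  have hab1 : 1 ≤ (a : ℤ) * b := by exact_mod_cast Nat.mul_pos ha hb
  have hRpos : 0 < R := by linarith [abs_nonneg e]
  have hUd : d ^ 2 < U := by
    have h2 : R ≤ a * b * R := le_mul_of_one_le_left hRpos.le hab1
    have h3 := neg_abs_le e
    linarith
  have hdz : d = 0 := by
    by_contra hne
    have hdpos : 0 < d ^ 2 := by positivity
    have hWU : W < U := by
      by_contra! hle
      nlinarith
    nlinarith
  have hfac : ((a : ℤ) - b) * (r + a * b) = 0 := by rw [← hdz, hd]; ring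
  have hne : (a : ℤ) - b ≠ 0 := by
    rw [sub_ne_zero]
    exact_mod_cast hab
  have := (mul_eq_zero.mp hfac).resolve_left hne
  linarith

/-- If square-related elements of `F` satisfy `ab = k`, then five elements contain three that are
pairwise inequivalent modulo squares. -/
theorem exists_three_of_five {F : Finset ℕ} {k : ℕ} (hF : 5 ≤ F.card) (hpos : ∀ a ∈ F, 0 < a)
    (h : ∀ a ∈ F, ∀ b ∈ F, a ≠ b → IsSquare (a * b) → a * b = k) :
    ∃ a ∈ F, ∃ b ∈ F, ∃ c ∈ F,
      ¬ IsSquare (a * b) ∧ ¬ IsSquare (a * c) ∧ ¬ IsSquare (b * c) := by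
  have hcard : ∀ a ∈ F, (F.filter fun b => IsSquare (a * b)).card ≤ 2 := by
    intro a ha
    have hsub : (F.filter fun b => IsSquare (a * b)) ⊆ {a, k / a} := by
      intro b hb
      rw [Finset.mem_filter] at hb
      rw [Finset.mem_insert, Finset.mem_singleton]
      by_cases hba : b = a
      · exact Or.inl hba
      · right
        rw [← h a ha b hb.1 (Ne.symm hba) hb.2, Nat.mul_div_cancel_left _ (hpos a ha)]
    exact (Finset.card_le_card hsub).trans Finset.card_le_two
  obtain ⟨a, ha⟩ : F.Nonempty := Finset.card_pos.mp (by omega)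
  set F₁ := F.filter fun b => ¬ IsSquare (a * b) with hF₁
  have h1 : 3 ≤ F₁.card := by
    have := Finset.card_filter_add_card_filter_not (s := F) fun b => IsSquare (a * b)
    have := hcard a ha
    rw [hF₁]
    omega
  obtain ⟨b, hb⟩ : F₁.Nonempty := Finset.card_pos.mp (by omega)
  have hb' := Finset.mem_filter.mp hb
  have h2 : 1 ≤ (F₁.filter fun c => ¬ IsSquare (b * c)).card := by
    have := Finset.card_filter_add_card_filter_not (s := F₁) fun c => IsSquare (b * c)
    have := hcard b hb'.1
    have : (F₁.filter fun c => IsSquare (b * c)).card ≤ (F.filter fun c => IsSquare (b * c)).card :=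
      Finset.card_le_card (Finset.filter_subset_filter _ (Finset.filter_subset _ F))
    omega
  obtain ⟨c, hc⟩ := Finset.card_pos.mp h2
  have hc' := Finset.mem_filter.mp hc
  have hc'' := Finset.mem_filter.mp hc'.1
  exact ⟨a, ha, b, hb'.1, c, hc''.1, hb'.2, hc''.2, hc'.2⟩

/-- Size facts about `E = e^V`, `H = e^(p⁴/4)` and the nearest square `R²` to `H⁴`. -/
theorem sub_one_le_and_le_add_one {E H R r : ℝ} (hE : 10 ^ 6 ≤ E) (hH : E ^ 10 ≤ H)
    (hR0 : 0 ≤ R) (hR : H ^ 4 = R ^ 2 + r) (hr : |r| ≤ 16 * E ^ 2) :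
    H ^ 2 - 1 ≤ R ∧ R ≤ H ^ 2 + 1 := by
  have hE1 : 1 ≤ E := by linarith
  have h1 : 16 * E ^ 2 ≤ E ^ 10 := by
    have h8 : (16 : ℝ) ≤ E ^ 8 := by
      calc (16 : ℝ) ≤ E := by linarith
        _ ≤ E ^ 8 := le_self_pow₀ hE1 (by norm_num)
    nlinarith [sq_nonneg E]
  have hH1 : 1 ≤ H := (one_le_pow₀ hE1).trans hH
  obtain ⟨hr1, hr2⟩ := abs_le.mp hr
  have hH2 : H ≤ H ^ 2 := le_self_pow₀ hH1 (by norm_num)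
  constructor
  · by_contra! hlt
    nlinarith
  · by_contra! hlt
    nlinarith

theorem sq_sub_add_abs_add_lt {E R a b r : ℝ} (hE : 10 ^ 6 ≤ E) (hR : E ^ 10 ≤ R) (ha : 0 ≤ a)
    (hb : 0 ≤ b) (haE : a ≤ E) (hbE : b ≤ E) (ha2 : a ^ 2 ≤ E) (hb2 : b ^ 2 ≤ E)
    (hr : |r| ≤ 16 * E ^ 2) :
    (a * (r - b ^ 2) - b * (r - a ^ 2)) ^ 2 + |a * (r - b ^ 2) + b * (r - a ^ 2)| < 4 * R := by
  have key : ∀ s t : ℝ, 0 ≤ s → s ≤ E → t ^ 2 ≤ E → |s * (r - t ^ 2)| ≤ 17 * E ^ 3 := by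
    intro s t hs hsE htE
    have h1 : |r - t ^ 2| ≤ 17 * E ^ 2 := by
      refine (abs_sub _ _).trans ?_
      rw [abs_of_nonneg (sq_nonneg t)]
      nlinarith
    rw [abs_mul, abs_of_nonneg hs]
    calc s * |r - t ^ 2| ≤ E * (17 * E ^ 2) := by gcongr
      _ = 17 * E ^ 3 := by ring
  have hx := key a b ha haE hb2
  have hy := key b a hb hbE ha2
  generalize a * (r - b ^ 2) = x at *
  generalize b * (r - a ^ 2) = y at *
  have h1 : |x + y| ≤ 34 * E ^ 3 := (abs_add_le x y).trans (by linarith)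
  have h2 : |x - y| ≤ 34 * E ^ 3 := (abs_sub x y).trans (by linarith)
  have h3 : (x - y) ^ 2 ≤ (34 * E ^ 3) ^ 2 := by
    rw [← sq_abs (x - y)]
    gcongr
  have h4 : E ^ 3 ≤ E ^ 6 := pow_le_pow_right₀ (by linarith) (by norm_num)
  have h5 : 10 ^ 6 * E ^ 6 ≤ E ^ 10 := by
    calc 10 ^ 6 * E ^ 6 ≤ E * E ^ 6 := by gcongr
      _ = E ^ 7 := by ring
      _ ≤ E ^ 10 := pow_le_pow_right₀ (by linarith) (by norm_num)
  have h6 : 0 < E ^ 6 := by positivity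
  nlinarith

theorem abs_mul_sub_mul_add_le {E B a b r : ℝ} (hB : 17 * B ≤ E) (hE : 1 ≤ E) (ha : 0 ≤ a)
    (hb : 0 ≤ b) (haB : a ^ 2 ≤ B) (hbB : b ^ 2 ≤ B) (hr : |r| ≤ 16 * E ^ 2) :
    |a * (a - b) * (a * b + r)| ≤ E ^ 3 := by
  have hab : a * b ≤ B := by nlinarith [sq_nonneg (a - b)]
  have h1 : |a * (a - b)| ≤ B := by
    rw [abs_le]
    constructor <;> nlinarith [mul_nonneg ha hb]
  have h2 : |a * b + r| ≤ 17 * E ^ 2 := by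
    refine (abs_add_le _ _).trans ?_
    rw [abs_of_nonneg (mul_nonneg ha hb)]
    nlinarith
  have hB0 : 0 ≤ B := (sq_nonneg a).trans haB
  rw [abs_mul]
  calc |a * (a - b)| * |a * b + r| ≤ B * (17 * E ^ 2) := by gcongr
    _ = 17 * B * E ^ 2 := by ring
    _ ≤ E * E ^ 2 := by gcongr
    _ = E ^ 3 := by ring

theorem card_offsets_le_four {p g Λ V : ℝ} (hΛ : 1 ≤ Λ)
    (hg : 10 ^ 11 * Λ ≤ g) (hgp : g ^ 12 ≤ p) (hexp : Real.exp Λ = p ^ 4)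
    (hV : V = p ^ 2 / g ^ 12)
    (hpell : ∀ D : ℕ, ¬ IsSquare D → (D : ℝ) ≤ 5329 * V → ∃ x y : ℕ, 0 < x ∧ 0 < y ∧
      x ^ 2 = D * y ^ 2 + 1 ∧ Real.log (x + y * √(D : ℝ)) ≤ p / g ^ 4)
    (hVE : 10 ^ 6 * V ≤ Real.exp V) (hV1 : 1 ≤ V) (hlogV : 5329 * V ≤ Real.exp (V / 2))
    (hVp : Real.exp V ^ 10 ≤ Real.exp (p ^ 4 / 4))
    {R : ℕ} {r : ℤ} (hR : Real.exp (p ^ 4 / 4) ^ 4 = (R : ℝ) ^ 2 + r)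
    (hr : |(r : ℝ)| ≤ 16 * Real.exp V ^ 2) {F : Finset ℕ}
    (hF : ∀ a ∈ F, 0 < a ∧ (a : ℝ) ^ 2 ≤ 5329 * V ∧
      ∃ x : ℕ, (x : ℤ) ^ 2 = 2 * a * R - a ^ 2 + r) : F.card ≤ 4 := by
  have hE6 : 10 ^ 6 ≤ Real.exp V := by linarith
  obtain ⟨hRlow, hRup⟩ := sub_one_le_and_le_add_one hE6 hVp (Nat.cast_nonneg R) hR hr
  have hH4 : Real.exp (p ^ 4) = Real.exp (p ^ 4 / 4) ^ 4 := by
    rw [← Real.exp_nat_mul]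
    congr 1
    push_cast
    ring
  have hE3 : Real.exp (3 * V) = Real.exp V ^ 3 := by rw [← Real.exp_nat_mul]; norm_num
  set E := Real.exp V with hE
  set H := Real.exp (p ^ 4 / 4) with hH
  have hEE : ∀ n : ℕ, 1 ≤ n → E ≤ E ^ n := fun n hn =>
    le_self_pow₀ (by linarith) (by omega)
  have hHbig : 10 ^ 6 ≤ H := by linarith [hEE 10 (by norm_num)]
  have hE3H : 100 * E ^ 3 ≤ H := by
    calc 100 * E ^ 3 ≤ E * E ^ 3 := by gcongr; linarith
      _ = E ^ 4 := by ring
      _ ≤ E ^ 10 := pow_le_pow_right₀ (by linarith) (by norm_num)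
      _ ≤ H := hVp
  have hE23 : 16 * E ^ 2 ≤ E ^ 3 := by nlinarith [sq_nonneg E]
  have hRE : E ^ 10 ≤ (R : ℝ) := by nlinarith
  have hRH : H ≤ (R : ℝ) := by nlinarith
  have haE : ∀ a ∈ F, (a : ℝ) ≤ 5329 * V := by
    intro a ha
    obtain ⟨h0, h1, -⟩ := hF a ha
    have : (1 : ℝ) ≤ a := by exact_mod_cast h0
    nlinarith
  by_contra! hcard
  have hsq : ∀ a ∈ F, ∀ b ∈ F, a ≠ b → IsSquare (a * b) → a * b = (-r).toNat := by
    intro a ha b hb hne hs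
    obtain ⟨ha0, ha1, u, hu⟩ := hF a ha
    obtain ⟨hb0, hb1, v, hv⟩ := hF b hb
    have hlt := sq_sub_add_abs_add_lt hE6 hRE (Nat.cast_nonneg a) (Nat.cast_nonneg b)
      (by linarith [haE a ha]) (by linarith [haE b hb]) (by linarith) (by linarith) hr
    have := eq_neg_mul_of_isSquare_mul ha0 hb0 hne hs hu hv (by exact_mod_cast hlt)
    have h2 : ((a * b : ℕ) : ℤ) = -r := by push_cast; linarith
    rw [← h2, Int.toNat_natCast]
  obtain ⟨a, ha, b, hb, c, hc, hab, hac, hbc⟩ :=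
    exists_three_of_five hcard (fun a ha => (hF a ha).1) hsq
  obtain ⟨ha0, ha1, x, hx⟩ := hF a ha
  obtain ⟨hb0, hb1, y, hy⟩ := hF b hb
  obtain ⟨hc0, hc1, w, hw⟩ := hF c hc
  have ha0R : (1 : ℝ) ≤ a := by exact_mod_cast ha0
  have hxR : (x : ℝ) ^ 2 = 2 * a * R - a ^ 2 + r := by exact_mod_cast hx
  have haR : (a : ℝ) ≤ E := by linarith [haE a ha]
  have hEH : E ≤ H := by linarith [hEE 3 (by norm_num)]
  obtain ⟨hr1, hr2⟩ := abs_le.mp hr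
  have hxlow : H ≤ (x : ℝ) ^ 2 := by
    have h1 : (R : ℝ) ≤ a * R := le_mul_of_one_le_left (by linarith) ha0R
    have h2 : (a : ℝ) ^ 2 ≤ a * R := by
      rw [sq]
      exact mul_le_mul_of_nonneg_left (by linarith) (Nat.cast_nonneg a)
    have h3 : 10 ^ 6 * H ≤ H ^ 2 := by
      rw [sq]
      gcongr
    rw [hxR]
    linarith
  have hx0 : 0 < x := by
    rw [Nat.pos_iff_ne_zero]
    rintro rfl
    norm_num at hxlow
    linarith
  have hxup : (x : ℝ) ^ 2 ≤ H ^ 4 := by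
    rw [hxR]
    have h1 : (a : ℝ) * R ≤ H * (H ^ 2 + 1) := by gcongr; linarith
    have h2 : 10 ^ 6 * H ^ 3 ≤ H ^ 4 := by
      calc 10 ^ 6 * H ^ 3 ≤ H * H ^ 3 := by gcongr
        _ = H ^ 4 := by ring
    have h3 : H ≤ H ^ 3 := le_self_pow₀ (by linarith) (by norm_num)
    have h4 : H * (H ^ 2 + 1) = H ^ 3 + H := by ring
    linarith [sq_nonneg (a : ℝ)]
  have hprod : ∀ s t : ℕ, (s : ℝ) ^ 2 ≤ 5329 * V → (t : ℝ) ^ 2 ≤ 5329 * V →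
      ((s * t : ℕ) : ℝ) ≤ 5329 * V := by
    intro s t hs ht
    push_cast
    linarith [sq_nonneg ((s : ℝ) - t), sub_sq (s : ℝ) t]
  have hlog : ∀ t ∈ F, Real.log t ≤ V / 2 := by
    intro t ht
    have h0 : (0 : ℝ) < t := by exact_mod_cast (hF t ht).1
    rw [Real.log_le_iff_le_exp h0]
    exact (haE t ht).trans hlogV
  have hnorm : ∀ t z : ℕ, (t : ℝ) ^ 2 ≤ 5329 * V → (z : ℤ) ^ 2 = 2 * t * R - t ^ 2 + r →
      |((((a * z : ℕ) : ℤ) ^ 2 - (a * t : ℕ) * (x : ℤ) ^ 2 : ℤ) : ℝ)| ≤ Real.exp (3 * V) := by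
    intro t z ht hz
    have h1 : ((a * z : ℕ) : ℤ) ^ 2 - (a * t : ℕ) * (x : ℤ) ^ 2 =
        a * (a - t) * (a * t + r) := by
      push_cast
      rw [mul_pow, hz, hx]
      ring
    rw [h1, hE3]
    push_cast
    exact abs_mul_sub_mul_add_le (by linarith) (by linarith) (Nat.cast_nonneg a)
      (Nat.cast_nonneg t) ha1 ht hr
  exact false_of_three_small_norms hΛ hg hgp hexp hV hpell ha0 hb0 hc0 hx0 hab hac hbc
    (hprod a b ha1 hb1) (hprod a c ha1 hc1) (hlog b hb) (hlog c hc) (hnorm b y hb1 hy)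
    (hnorm c w hc1 hw) hxlow (hxup.trans_eq hH4.symm)

/-- Each offset `R - |m|` accounts for at most four representations `m² + n² = N`. -/
theorem encard_le_four_mul_card_offsets {N R : ℕ} {F : Finset ℕ} {S : Set (ℤ × ℤ)}
    (hS : ∀ x ∈ S, x.1 ^ 2 + x.2 ^ 2 = N ∧ ∃ a ∈ F, |x.1| = R - a) :
    S.encard ≤ (F.card * 4 : ℕ) := by
  set G : ℕ → Finset (ℤ × ℤ) := fun a =>
    {(R - a : ℤ), -(R - a : ℤ)} ×ˢ
      {(Nat.sqrt (N - (R - a : ℤ) ^ 2).toNat : ℤ), -(Nat.sqrt (N - (R - a : ℤ) ^ 2).toNat : ℤ)}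
    with hG
  have hcard : (F.biUnion G).card ≤ F.card * 4 := by
    refine Finset.card_biUnion_le_card_mul _ _ _ fun a _ => ?_
    rw [hG, Finset.card_product]
    exact Nat.mul_le_mul Finset.card_le_two Finset.card_le_two
  have hsub : S ⊆ (F.biUnion G : Finset (ℤ × ℤ)) := by
    rintro ⟨m, n⟩ hx
    obtain ⟨hN, a, ha, hm⟩ := hS _ hx
    dsimp only at hN hm
    have hn : (N : ℤ) - (R - a) ^ 2 = n ^ 2 := by
      rw [← hm, sq_abs]
      linarith
    have hsqrt : (Nat.sqrt ((N : ℤ) - (R - a) ^ 2).toNat : ℤ) = |n| := by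
      rw [hn, ← Int.natAbs_sq, ← Nat.cast_pow, Int.toNat_natCast, Nat.sqrt_eq', Int.natCast_natAbs]
    rw [Finset.mem_coe, Finset.mem_biUnion]
    refine ⟨a, ha, ?_⟩
    simp only [hG, hsqrt, Finset.mem_product, Finset.mem_insert, Finset.mem_singleton]
    rw [← hm]
    constructor
    · rcases abs_choice m with h | h <;> rw [h] <;> simp
    · rcases abs_choice n with h | h <;> rw [h] <;> simp
  calc S.encard ≤ ((F.biUnion G : Finset (ℤ × ℤ)) : Set (ℤ × ℤ)).encard := Set.encard_le_encard hsub
    _ = ((F.biUnion G).card : ℕ∞) := Set.encard_coe_eq_coe_finsetCard _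
    _ ≤ (F.card * 4 : ℕ) := by exact_mod_cast hcard

theorem offset_mul_bound_le {v R H E : ℝ} (hv : 1 ≤ v) (hE : 17 * E ^ 2 + 73 ≤ H ^ 2)
    (hR : H ^ 2 - 1 ≤ R) : 36 * H ^ 2 * v + 16 * E ^ 2 ≤ 73 * v * R := by
  have h2 : v * (H ^ 2 - 1) ≤ v * R := by gcongr
  have h3 : v * (17 * E ^ 2 + 73) ≤ v * H ^ 2 := by gcongr
  have h4 : 17 * E ^ 2 ≤ v * (17 * E ^ 2) := le_mul_of_one_le_left (by positivity) hv
  have h5 : 0 ≤ v * H ^ 2 := by positivity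
  have h6 : 0 ≤ E ^ 2 := sq_nonneg E
  linarith

theorem encard_points_le_twenty {p g Λ V : ℝ} (hΛ : 1 ≤ Λ)
    (hg : 10 ^ 11 * Λ ≤ g) (hgp : g ^ 12 ≤ p) (hexp : Real.exp Λ = p ^ 4)
    (hV : V = p ^ 2 / g ^ 12)
    (hpell : ∀ D : ℕ, ¬ IsSquare D → (D : ℝ) ≤ 5329 * V → ∃ x y : ℕ, 0 < x ∧ 0 < y ∧
      x ^ 2 = D * y ^ 2 + 1 ∧ Real.log (x + y * √(D : ℝ)) ≤ p / g ^ 4)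
    (hVE : 10 ^ 6 * V ≤ Real.exp V) (hV1 : 1 ≤ V) (hlogV : 5329 * V ≤ Real.exp (V / 2))
    (hVp : Real.exp V ^ 10 ≤ Real.exp (p ^ 4 / 4))
    {N R : ℕ} (hN : Real.exp (p ^ 4 / 4) ^ 4 = N)
    (hr : |(N : ℝ) - (R : ℝ) ^ 2| ≤ 16 * Real.exp V ^ 2) {Y : ℝ}
    (hY : Y ^ 2 ≤ 36 * Real.exp (p ^ 4 / 4) ^ 2 * √V) :
    {x : ℤ × ℤ | x.1 ^ 2 + x.2 ^ 2 = (N : ℤ) ∧ (|x.2| : ℝ) ≤ Y}.encard ≤ 20 := by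
  classical
  set r : ℤ := N - (R : ℤ) ^ 2 with hrdef
  have hrR : (r : ℝ) = N - (R : ℝ) ^ 2 := by rw [hrdef]; push_cast; ring
  rw [← hrR] at hr
  have hR : Real.exp (p ^ 4 / 4) ^ 4 = (R : ℝ) ^ 2 + r := by rw [hN, hrR]; ring
  set F : Finset ℕ := (Finset.range (⌊5329 * V⌋₊ + 1)).filter fun a =>
    0 < a ∧ (a : ℝ) ^ 2 ≤ 5329 * V ∧ ∃ x : ℕ, (x : ℤ) ^ 2 = 2 * a * R - a ^ 2 + r with hF
  have hF4 : F.card ≤ 4 := card_offsets_le_four hΛ hg hgp hexp hV hpell hVE hV1 hlogV hVp hR hr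
    fun a ha => (Finset.mem_filter.mp ha).2
  have hE6 : 10 ^ 6 ≤ Real.exp V := by linarith
  obtain ⟨hRlow, hRup⟩ := sub_one_le_and_le_add_one hE6 hVp (Nat.cast_nonneg R) hR hr
  set E := Real.exp V with hE
  set H := Real.exp (p ^ 4 / 4) with hH
  have hEE : E ≤ E ^ 2 := le_self_pow₀ (by linarith) (by norm_num)
  have hE2H : 10 ^ 6 * E ^ 2 ≤ H := by
    calc 10 ^ 6 * E ^ 2 ≤ E * E ^ 2 := by gcongr
      _ = E ^ 3 := by ring
      _ ≤ E ^ 10 := pow_le_pow_right₀ (by linarith) (by norm_num)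
      _ ≤ H := hVp
  have hHH : H ≤ H ^ 2 := le_self_pow₀ (by linarith) (by norm_num)
  have hRpos : (0 : ℝ) < R := by linarith
  have hv1 : 1 ≤ √V := Real.one_le_sqrt.mpr hV1
  have hvV : √V ^ 2 = V := Real.sq_sqrt (by linarith)
  obtain ⟨hr1, hr2⟩ := abs_le.mp hr
  have hr3 : r < 2 * R + 1 := by
    have : (r : ℝ) < 2 * R + 1 := by linarith
    exact_mod_cast this
  have key : ∀ x ∈ {x : ℤ × ℤ | x.1 ^ 2 + x.2 ^ 2 = (N : ℤ) ∧ (|x.2| : ℝ) ≤ Y},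
      x.1 ^ 2 + x.2 ^ 2 = N ∧ ∃ a ∈ insert 0 F, |x.1| = R - a := by
    rintro ⟨m, n⟩ ⟨hmn, hn⟩
    dsimp only at hmn hn ⊢
    refine ⟨hmn, ?_⟩
    have hmR : |m| ≤ R := by
      have h1 : m ^ 2 < ((R : ℤ) + 1) ^ 2 := by nlinarith [sq_nonneg n]
      have h2 := abs_lt_of_sq_lt_sq h1 (by positivity)
      omega
    obtain ⟨a, ha⟩ := Int.eq_ofNat_of_zero_le (sub_nonneg.mpr hmR)
    have hm : |m| = R - a := by omega
    have hm2 : m ^ 2 = ((R : ℤ) - a) ^ 2 := by rw [← hm, sq_abs]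
    have haR : (a : ℤ) ≤ R := by have := abs_nonneg m; omega
    have hna : n ^ 2 = 2 * a * R - a ^ 2 + r := by
      rw [hrdef]
      linarith
    refine ⟨a, ?_, hm⟩
    rw [Finset.mem_insert]
    rcases Nat.eq_zero_or_pos a with h0 | h0
    · exact Or.inl h0
    right
    have haR' : (a : ℝ) ≤ R := by exact_mod_cast haR
    have hnaR : (n : ℝ) ^ 2 = 2 * a * R - a ^ 2 + r := by exact_mod_cast hna
    have hnY : (n : ℝ) ^ 2 ≤ Y ^ 2 := by
      rw [← sq_abs (n : ℝ)]
      exact pow_le_pow_left₀ (abs_nonneg _) hn 2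
    have ha73 : (a : ℝ) ≤ 73 * √V := by
      refine le_of_mul_le_mul_right ?_ hRpos
      have h1 : (a : ℝ) ^ 2 ≤ a * R := by
        rw [sq]
        exact mul_le_mul_of_nonneg_left haR' (Nat.cast_nonneg a)
      have h2 : (a : ℝ) * R ≤ 36 * H ^ 2 * √V + 16 * E ^ 2 := by linarith
      exact h2.trans (offset_mul_bound_le hv1 (by linarith) hRlow)
    have ha2 : (a : ℝ) ^ 2 ≤ 5329 * V := by
      calc (a : ℝ) ^ 2 ≤ (73 * √V) ^ 2 := by gcongr
        _ = 5329 * V := by rw [mul_pow, hvV]; norm_num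
    have haV : (a : ℝ) ≤ 5329 * V := by
      have : (1 : ℝ) ≤ a := by exact_mod_cast h0
      exact (le_self_pow₀ this two_ne_zero).trans ha2
    rw [hF, Finset.mem_filter, Finset.mem_range]
    refine ⟨Nat.lt_succ_of_le (Nat.le_floor haV), h0, ha2, n.natAbs, ?_⟩
    rw [Int.natAbs_sq, hna]
  refine (encard_le_four_mul_card_offsets key).trans ?_
  have : (insert 0 F).card * 4 ≤ 20 := by
    have := Finset.card_insert_le 0 F
    omega
  exact_mod_cast this

theorem eventually_growth_conditions {ε : ℝ} (hε0 : 0 < ε) (hε1 : ε < 1 / 100) (C : ℝ) :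
    ∀ᶠ L : ℝ in Filter.atTop, 1 ≤ Real.log L ∧ 10 ^ 11 * Real.log L ≤ L ^ (ε / 12) ∧
      10 ^ 11 ≤ L ^ ((1 : ℝ) / 2 - ε) ∧ 40 ≤ L ^ (1 / 2 + ε) ∧ C * 5329 ≤ L ^ (ε / 8) := by
  have h1 := (isLittleO_log_rpow_atTop (by positivity : 0 < ε / 12)).bound
    (by norm_num : (0 : ℝ) < 1 / 10 ^ 11)
  filter_upwards [h1, Real.tendsto_log_atTop.eventually_ge_atTop 1, Filter.eventually_ge_atTop 0,
    (tendsto_rpow_atTop (by linarith : 0 < (1 : ℝ) / 2 - ε)).eventually_ge_atTop (10 ^ 11),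
    (tendsto_rpow_atTop (by linarith : 0 < 1 / 2 + ε)).eventually_ge_atTop 40,
    (tendsto_rpow_atTop (by linarith : 0 < ε / 8)).eventually_ge_atTop (C * 5329)]
    with L h2 h3 h4 h5 h6 h7
  refine ⟨h3, ?_, h5, h6, h7⟩
  rw [Real.norm_of_nonneg (by linarith), Real.norm_of_nonneg (Real.rpow_nonneg h4 _)] at h2
  linarith

theorem exp_bounds_of_large {V : ℝ} (hV : 10 ^ 11 ≤ V) :
    10 ^ 6 * V ≤ Real.exp V ∧ 5329 * V ≤ Real.exp (V / 2) := by
  have h1 := Real.quadratic_le_exp_of_nonneg (by linarith : 0 ≤ V)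
  have h2 := Real.quadratic_le_exp_of_nonneg (by linarith : 0 ≤ V / 2)
  constructor <;> nlinarith

theorem pell_bound_le {ε L C D : ℝ} (hε0 : 0 < ε) (hε1 : ε < 1 / 100) (hL : 1 ≤ L) (hC : 0 ≤ C)
    (hCL : C * 5329 ≤ L ^ (ε / 8)) (hD0 : 0 ≤ D) (hD : D ≤ 5329 * L ^ ((1 : ℝ) / 2 - ε)) :
    C * D ^ (1 / 2 + ε / 12) ≤ L ^ ((1 : ℝ) / 4) / (L ^ (ε / 12)) ^ 4 := by
  have hL0 : 0 < L := by linarith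
  have h1 : D ^ (1 / 2 + ε / 12) ≤ 5329 * L ^ (1 / 4 - 11 * ε / 24) := by
    calc D ^ (1 / 2 + ε / 12) ≤ (5329 * L ^ ((1 : ℝ) / 2 - ε)) ^ (1 / 2 + ε / 12) := by gcongr
      _ = 5329 ^ (1 / 2 + ε / 12) * L ^ (((1 : ℝ) / 2 - ε) * (1 / 2 + ε / 12)) := by
        rw [Real.mul_rpow (by norm_num) (by positivity), ← Real.rpow_mul hL0.le]
      _ ≤ 5329 ^ (1 : ℝ) * L ^ (1 / 4 - 11 * ε / 24) := by
        gcongr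
        · norm_num
        · linarith
        · nlinarith [sq_nonneg ε]
      _ = 5329 * L ^ (1 / 4 - 11 * ε / 24) := by rw [Real.rpow_one]
  have h2 : L ^ ((1 : ℝ) / 4) / (L ^ (ε / 12)) ^ 4 = L ^ (ε / 8) * L ^ (1 / 4 - 11 * ε / 24) := by
    rw [← Real.rpow_mul_natCast hL0.le, ← Real.rpow_sub hL0, ← Real.rpow_add hL0]
    congr 1
    push_cast
    ring
  rw [h2]
  calc C * D ^ (1 / 2 + ε / 12) ≤ C * (5329 * L ^ (1 / 4 - 11 * ε / 24)) := by gcongr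
    _ = C * 5329 * L ^ (1 / 4 - 11 * ε / 24) := by ring
    _ ≤ L ^ (ε / 8) * L ^ (1 / 4 - 11 * ε / 24) := by gcongr

theorem stmt_6 (ε : ℝ) (hε0 : 0 < ε) (hε1 : ε < 1 / 100) :
    ∃ N₀ : ℕ, ∀ N : ℕ, N₀ ≤ N →
      (∃ R : ℕ, |(N : ℝ) - (R : ℝ) ^ 2| ≤ 16 * Real.exp (2 * Real.log N ^ ((1 : ℝ) / 2 - ε))) →
      {x : ℤ × ℤ | x.1 ^ 2 + x.2 ^ 2 = (N : ℤ) ∧ (|x.2| : ℝ) ≤ 6 * (N : ℝ) ^ ((1 : ℝ) / 4) *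
            Real.log N ^ (((1 : ℝ) / 2 - ε) / 4)}.encard ≤ 20 := by
  obtain ⟨C, hC1, hC⟩ := exists_pell_log_le (δ := ε / 12) (by positivity)
  have hev := (Real.tendsto_log_atTop.comp tendsto_natCast_atTop_atTop).eventually
    (eventually_growth_conditions hε0 hε1 C)
  obtain ⟨N₀, hN₀⟩ := Filter.eventually_atTop.mp (hev.and (Filter.eventually_ge_atTop 3))
  refine ⟨N₀, fun N hN ⟨R, hR⟩ => ?_⟩
  obtain ⟨⟨hΛ, hg, hV11, h40, hCL⟩, hN3⟩ := hN₀ N hN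
  simp only [Function.comp_apply] at hΛ hg hV11 h40 hCL
  have hNpos : (0 : ℝ) < N := by
    have : (3 : ℝ) ≤ N := by exact_mod_cast hN3
    linarith
  have hexpL : Real.exp (Real.log N) = N := Real.exp_log hNpos
  have hN4 : (N : ℝ) ^ ((1 : ℝ) / 4) = Real.exp (Real.log N / 4) := by
    rw [Real.rpow_def_of_pos hNpos]
    congr 1
    ring
  have hL1 : 1 ≤ Real.log N := by
    have hN3' : (3 : ℝ) ≤ N := by exact_mod_cast hN3
    rw [Real.le_log_iff_exp_le hNpos]
    exact Real.exp_one_lt_three.le.trans hN3'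
  rw [hN4]
  generalize Real.log N = L at *
  have hL0 : 0 < L := by linarith
  have hp4 : (L ^ ((1 : ℝ) / 4)) ^ 4 = L := by
    rw [← Real.rpow_mul_natCast hL0.le]
    norm_num
  obtain ⟨hVE, hlogV⟩ := exp_bounds_of_large hV11
  refine encard_points_le_twenty (p := L ^ ((1 : ℝ) / 4)) (g := L ^ (ε / 12)) (Λ := Real.log L)
    (V := L ^ ((1 : ℝ) / 2 - ε)) (R := R) hΛ hg ?_ ?_ ?_ ?_ hVE (by linarith) hlogV ?_ ?_ ?_ ?_
  · rw [← Real.rpow_mul_natCast hL0.le]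
    exact Real.rpow_le_rpow_of_exponent_le hL1 (by push_cast; linarith)
  · rw [hp4, Real.exp_log hL0]
  · rw [← Real.rpow_mul_natCast hL0.le, ← Real.rpow_mul_natCast hL0.le, ← Real.rpow_sub hL0]
    congr 1
    push_cast
    ring
  · intro D hD hDV
    obtain ⟨x, y, hx, hy, hxy, hlog⟩ := hC D hD
    exact ⟨x, y, hx, hy, hxy, hlog.trans
      (pell_bound_le hε0 hε1 hL1 (by linarith) hCL (Nat.cast_nonneg D) hDV)⟩
  · rw [hp4, ← Real.exp_nat_mul, Real.exp_le_exp]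
    have h1 : L ^ ((1 : ℝ) / 2 - ε) * L ^ (1 / 2 + ε) = L := by
      rw [← Real.rpow_add hL0]
      norm_num
    push_cast
    nlinarith
  · rw [hp4, ← hexpL, ← Real.exp_nat_mul]
    congr 1
    push_cast
    ring
  · rw [← Real.exp_nat_mul]
    exact_mod_cast hR
  · rw [hp4, Real.sqrt_eq_rpow, ← Real.rpow_mul hL0.le, mul_pow, mul_pow,
      ← Real.rpow_mul_natCast hL0.le]
    refine le_of_eq ?_
    norm_num
    congr 1
    ring
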